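/- Let k ≥ 1 and m ≥ 3 be integers, let λ_0, …, λ_k be integers with λ_j ≠ 0 for at least one index j, and let α_1, …, α_k be pairwise distinct non-zero integers. Assume RH and GRH_m. Let ε ∈ (0,1) be a real number and let R be a union of primes in at least (k+ε)·φ(m)/(k+1) residue classes in the reduced residue system modulo m. Suppose H is a real number with max_{0≤i≤k}|λ_i| ≤ H such that (log H)/ε ≥ s·e^s for some real number s ≥ max{1866, m^{φ(m)}+1, c_1+1, ((15.195k+16.195)/ε)^{1.5}+1}. Then there exists a prime p with log( log H/(ε·log(log H/ε)) ) < p < k·( 12.994·log H/(ε·log(log H/ε)) + 2 ), p ∈ R, such that |λ_0 + λ_1·F_p(α_1) + … + λ_k·F_p(α_k)|_p > H^{−(k/ε+1) − (197.444k²/ε + 210.438k/ε + 1.726k² − 0.529k + 12.995)·log log(0.072·log H)/(ε·log log H)}; moreover, if k ≥ 2, such a prime p exists with the stronger bound |λ_0 + λ_1·F_p(α_1) + … + λ_k·F_p(α_k)|_p > H^{−(k/ε+1) − (97.932k²/ε + 104.377k/ε + 0.856k² − 0.262k + 6.446)·log log(0.02·log H)/(ε·log log H)}. -/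

import Mathlib

open scoped BigOperators
open Filter Real
open scoped Nat

noncomputable section

/-- The Riemann Hypothesis: every zero of the Riemann zeta function in the
critical strip lies on the critical line. -/
def RH : Prop :=
  ∀ s : ℂ, riemannZeta s = 0 → 0 < s.re → s.re < 1 → s.re = 1 / 2

/-- GRH for Dirichlet L-functions modulo `m` (equivalently, for the `m`-th
cyclotomic Dedekind zeta function). -/
def GRH (m : ℕ) : Prop :=
  ∀ (_ : NeZero m) (χ : DirichletCharacter ℂ m) (s : ℂ),
    DirichletCharacter.LFunction χ s = 0 → 0 < s.re → s.re < 1 → s.re = 1 / 2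

/-- Euler's factorial series `F_p(t) = ∑ n! tⁿ` in `ℚ_p`. -/
def eulerF (p : ℕ) [Fact p.Prime] (t : ℤ) : ℚ_[p] :=
  ∑' n : ℕ, (n ! : ℚ_[p]) * (t : ℚ_[p]) ^ n

/-- `max_{1≤j≤k} |α_j|` as a natural number. -/
def maxAbs {k : ℕ} (α : Fin k → ℤ) : ℕ :=
  Finset.univ.sup fun j => (α j).natAbs

/-- `max_{1≤j≤k} |α_j|_p`. -/
def padicMaxAbs (p : ℕ) {k : ℕ} (α : Fin k → ℤ) : ℝ :=
  ⨆ j, ((padicNorm p ((α j : ℚ))) : ℝ)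

/-- `c₁ = 2^k (max |α_j|)^k`. -/
def c1val (k : ℕ) (α : Fin k → ℤ) : ℝ := 2 ^ k * (maxAbs α : ℝ) ^ k

/-- `c₂(ᾱ; R) = c₁ ∏_{p ∈ R} (max_i |α_i|_p)^{k+1}`. -/
def c2val (k : ℕ) (α : Fin k → ℤ) (R : Set ℕ) : ℝ :=
  c1val k α * ∏' p : R, padicMaxAbs (p : ℕ) α ^ (k + 1)

/-- `D(m,k,ᾱ;R)`. -/
def Dval (m k : ℕ) (α : Fin k → ℤ) (R : Set ℕ) : ℝ :=
  -(Real.log (c2val k α R) + k * (Real.log k + (Real.log m + 6.550) * m.totient + 1))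

/-! ### Padé approximations to Euler's factorial series -/

section Pade

open Polynomial

/-- The polynomial `∏ (X - α_j)^{e_j}`. -/
def padeBase {k : ℕ} (α : Fin k → ℤ) (e : Fin k → ℕ) : ℤ[X] :=
  ∏ j, (X - C (α j)) ^ e j

/-- The coefficients of the common denominator. -/
def padeCoeff {k : ℕ} (α : Fin k → ℤ) (e : Fin k → ℕ) (i : ℕ) : ℤ :=
  ((∑ j, e j).descFactorial ((∑ j, e j) - i) : ℤ) * (padeBase α e).coeff i

/-- The common denominator of the Padé approximations. -/
def padeDen {k : ℕ} (α : Fin k → ℤ) (e : Fin k → ℕ) : ℤ[X] :=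
  ∑ i ∈ Finset.range ((∑ j, e j) + 1), C (padeCoeff α e i) * X ^ ((∑ j, e j) - i)

/-- The numerator of the Padé approximation to `∑ n! (a X)^n`. -/
def padeNum {k : ℕ} (α : Fin k → ℤ) (e : Fin k → ℕ) (a : ℤ) : ℤ[X] :=
  ∑ i ∈ Finset.range ((∑ j, e j) + 1), ∑ n ∈ Finset.range i,
    C (padeCoeff α e i * (n ! * a ^ n)) * X ^ ((∑ j, e j) - i + n)

/-- The coefficients of the remainder series. -/
def padeRem {k : ℕ} (α : Fin k → ℤ) (e : Fin k → ℕ) (a : ℤ) (n : ℕ) : ℤ :=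
  ∑ i ∈ Finset.range ((∑ j, e j) + 1), padeCoeff α e i * ((n + i)! * a ^ (n + i))

/-- The formal series `∑ n! (a X)^n`. -/
def factSeries (a : ℤ) : PowerSeries ℤ := PowerSeries.mk fun n => (n ! : ℤ) * a ^ n

variable {k : ℕ} (α : Fin k → ℤ) (e : Fin k → ℕ)

lemma padeBase_monic : (padeBase α e).Monic :=
  monic_prod_of_monic _ _ fun _ _ => (monic_X_sub_C _).pow _

lemma padeBase_natDegree : (padeBase α e).natDegree = ∑ j, e j := by
  unfold padeBase
  rw [natDegree_prod_of_monic _ _ fun _ _ => (monic_X_sub_C _).pow _]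
  simp only [natDegree_pow, natDegree_X_sub_C, mul_one]

lemma padeCoeff_mul_factorial {i : ℕ} (hi : i ≤ ∑ j, e j) :
    padeCoeff α e i * (i ! : ℤ) = ((∑ j, e j)! : ℤ) * (padeBase α e).coeff i := by
  have h := Nat.factorial_mul_descFactorial (n := ∑ j, e j) (k := (∑ j, e j) - i) (by omega)
  rw [Nat.sub_sub_self hi] at h
  unfold padeCoeff
  rw [← h]
  push_cast
  ring

lemma padeCoeff_top : padeCoeff α e (∑ j, e j) = 1 := by
  have := (padeBase_monic α e).coeff_natDegree
  rw [padeBase_natDegree] at this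
  simp [padeCoeff, this]

lemma taylor_X_pow_mul_coeff (P : ℤ[X]) (a : ℤ) (n N : ℕ) (hN : P.natDegree < N) :
    (taylor a (X ^ n * P)).coeff n
      = ∑ i ∈ Finset.range N, ((n + i).choose n : ℤ) * P.coeff i * a ^ i := by
  rw [taylor_coeff]
  conv_lhs => rw [P.as_sum_range' N hN]
  rw [Finset.mul_sum, map_sum, eval_finsetSum]
  refine Finset.sum_congr rfl fun i _ => ?_
  have : (X : ℤ[X]) ^ n * monomial i (P.coeff i) = monomial (n + i) (P.coeff i) := by
    rw [X_pow_mul_monomial, add_comm]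
  rw [this, hasseDeriv_monomial, eval_monomial]
  simp

lemma padeRem_eq (a : ℤ) (n : ℕ) :
    padeRem α e a n
      = ((∑ j, e j)! : ℤ) * n ! * a ^ n * (taylor a (X ^ n * padeBase α e)).coeff n := by
  rw [taylor_X_pow_mul_coeff _ _ _ ((∑ j, e j) + 1) (by rw [padeBase_natDegree]; omega),
    Finset.mul_sum]
  unfold padeRem
  refine Finset.sum_congr rfl fun i hi => ?_
  have hi' : i ≤ ∑ j, e j := by simpa [Nat.lt_succ_iff] using hi
  have h1 := padeCoeff_mul_factorial α e hi'
  have h2 : ((n + i)! : ℤ) = (n + i).choose n * n ! * i ! := by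
    have := Nat.choose_mul_factorial_mul_factorial (Nat.le_add_right n i)
    rw [Nat.add_sub_cancel_left] at this
    rw [← this]; push_cast; ring
  rw [h2, pow_add]
  linear_combination ((n + i).choose n * n ! * a ^ n * a ^ i : ℤ) * h1

lemma padeBase_eq (j : Fin k) :
    padeBase α e = (X - C (α j)) ^ e j * ∏ i ∈ Finset.univ.erase j, (X - C (α i)) ^ e i :=
  (Finset.mul_prod_erase _ (fun i => (X - C (α i)) ^ e i) (Finset.mem_univ j)).symm

lemma taylor_padeBase (j : Fin k) (n : ℕ) :
    taylor (α j) (X ^ n * padeBase α e) = X ^ e j *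
      taylor (α j) (X ^ n * ∏ i ∈ Finset.univ.erase j, (X - C (α i)) ^ e i) := by
  rw [padeBase_eq α e j]
  simp only [taylor_mul, taylor_pow]
  have : taylor (α j) (X - C (α j)) = X := by
    rw [map_sub, taylor_X, taylor_C, add_sub_cancel_right]
  rw [this]
  ring

lemma padeRem_eq_zero (j : Fin k) {n : ℕ} (hn : n < e j) : padeRem α e (α j) n = 0 := by
  rw [padeRem_eq, taylor_padeBase, coeff_X_pow_mul', if_neg (by omega), mul_zero]

lemma padeRem_ne_zero (hα : ∀ j, α j ≠ 0) (hinj : Function.Injective α) (j : Fin k) :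
    padeRem α e (α j) (e j) ≠ 0 := by
  rw [padeRem_eq, taylor_padeBase, coeff_X_pow_mul', if_pos le_rfl, Nat.sub_self,
    taylor_coeff_zero]
  have h1 : ((∑ j, e j)! : ℤ) ≠ 0 := by exact_mod_cast Nat.factorial_ne_zero _
  have h2 : ((e j)! : ℤ) ≠ 0 := by exact_mod_cast Nat.factorial_ne_zero _
  refine mul_ne_zero (mul_ne_zero (mul_ne_zero h1 h2) (pow_ne_zero _ (hα j))) ?_
  rw [eval_mul, eval_prod]
  refine mul_ne_zero (by simpa using pow_ne_zero _ (hα j)) ?_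
  rw [Finset.prod_ne_zero_iff]
  intro i hi
  have hij : i ≠ j := Finset.ne_of_mem_erase hi
  simp only [eval_pow, eval_sub, eval_X, eval_C]
  exact pow_ne_zero _ (sub_ne_zero.2 fun h => hij (hinj h.symm))

lemma factorial_mul_dvd_padeRem (j : Fin k) (n : ℕ) :
    (((∑ j, e j)! * (e j)! : ℕ) : ℤ) ∣ padeRem α e (α j) n := by
  rcases lt_or_ge n (e j) with hn | hn
  · rw [padeRem_eq_zero α e j hn]; exact dvd_zero _
  · rw [padeRem_eq]
    push_cast
    refine Dvd.dvd.mul_right (Dvd.dvd.mul_right (mul_dvd_mul_left _ ?_) _) _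
    exact_mod_cast Nat.factorial_dvd_factorial hn

lemma pade_identity (a : ℤ) :
    (padeDen α e : PowerSeries ℤ) * factSeries a - (padeNum α e a : PowerSeries ℤ)
      = PowerSeries.X ^ (∑ j, e j) * PowerSeries.mk (padeRem α e a) := by
  have key : ∀ i : ℕ, factSeries a =
      PowerSeries.X ^ i * PowerSeries.mk (fun n => ((n + i)! : ℤ) * a ^ (n + i))
      + ((∑ n ∈ Finset.range i, C ((n ! : ℤ) * a ^ n) * X ^ n : ℤ[X]) : PowerSeries ℤ) := by
    intro i
    ext n
    rw [map_add, PowerSeries.coeff_X_pow_mul', Polynomial.coeff_coe, finsetSum_coeff]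
    simp only [factSeries, PowerSeries.coeff_mk, coeff_C_mul, coeff_X_pow, mul_ite, mul_one,
      mul_zero, Finset.sum_ite_eq, Finset.mem_range]
    by_cases h : i ≤ n
    · simp [h, Nat.sub_add_cancel h]
    · simp [h, not_le.1 h]
  have hX : PowerSeries.mk (padeRem α e a) = ∑ i ∈ Finset.range ((∑ j, e j) + 1),
      PowerSeries.C (padeCoeff α e i) *
        PowerSeries.mk (fun n => ((n + i)! : ℤ) * a ^ (n + i)) := by
    ext n
    simp only [padeRem, map_sum, PowerSeries.coeff_C_mul, PowerSeries.coeff_mk]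
  have hD : (padeDen α e : PowerSeries ℤ) = ∑ i ∈ Finset.range ((∑ j, e j) + 1),
      PowerSeries.C (padeCoeff α e i) * PowerSeries.X ^ ((∑ j, e j) - i) := by
    unfold padeDen
    rw [← coeToPowerSeries.ringHom_apply, map_sum]
    simp only [coeToPowerSeries.ringHom_apply, coe_mul, coe_C, coe_pow, coe_X]
  have hN : (padeNum α e a : PowerSeries ℤ) = ∑ i ∈ Finset.range ((∑ j, e j) + 1),
      PowerSeries.C (padeCoeff α e i) * PowerSeries.X ^ ((∑ j, e j) - i) *
      ((∑ n ∈ Finset.range i, C ((n ! : ℤ) * a ^ n) * X ^ n : ℤ[X]) : PowerSeries ℤ) := by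
    unfold padeNum
    simp only [← coeToPowerSeries.ringHom_apply, map_sum]
    refine Finset.sum_congr rfl fun i _ => ?_
    rw [Finset.mul_sum]
    refine Finset.sum_congr rfl fun n _ => ?_
    simp only [coeToPowerSeries.ringHom_apply, coe_mul, coe_C, coe_pow, coe_X, pow_add, C_mul]
    ring
  rw [hD, hN, hX, Finset.sum_mul, Finset.mul_sum, ← Finset.sum_sub_distrib]
  refine Finset.sum_congr rfl fun i hi => ?_
  have hi' : i ≤ ∑ j, e j := by simpa [Nat.lt_succ_iff] using hi
  have hp : (PowerSeries.X : PowerSeries ℤ) ^ (∑ j, e j)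
      = PowerSeries.X ^ ((∑ j, e j) - i) * PowerSeries.X ^ i := by
    rw [← pow_add, Nat.sub_add_cancel hi']
  rw [hp]
  conv_lhs => rw [key i]
  ring

end Pade

section PadeBounds

open Polynomial

variable {k : ℕ} (α : Fin k → ℤ) (e : Fin k → ℕ)

/-- Coefficientwise domination of an integer polynomial by another one. -/
def CoeffDominated (P Q : ℤ[X]) : Prop := ∀ i, |P.coeff i| ≤ Q.coeff i

lemma CoeffDominated.mul {P Q P' Q' : ℤ[X]} (h : CoeffDominated P Q)
    (h' : CoeffDominated P' Q') : CoeffDominated (P * P') (Q * Q') := by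
  intro i
  rw [coeff_mul, coeff_mul]
  refine (Finset.abs_sum_le_sum_abs _ _).trans (Finset.sum_le_sum fun x _ => ?_)
  rw [abs_mul]
  exact mul_le_mul (h _) (h' _) (abs_nonneg _) ((abs_nonneg _).trans (h _))

lemma coeffDominated_one : CoeffDominated 1 1 := by
  intro i
  rw [coeff_one]
  split_ifs <;> simp

lemma CoeffDominated.pow {P Q : ℤ[X]} (h : CoeffDominated P Q) (n : ℕ) :
    CoeffDominated (P ^ n) (Q ^ n) := by
  induction n with
  | zero => simpa using coeffDominated_one
  | succ n ih => rw [pow_succ, pow_succ]; exact ih.mul h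

lemma CoeffDominated.prod {ι : Type*} (s : Finset ι) {P Q : ι → ℤ[X]}
    (h : ∀ i, CoeffDominated (P i) (Q i)) : CoeffDominated (∏ i ∈ s, P i) (∏ i ∈ s, Q i) := by
  classical
  induction s using Finset.induction_on with
  | empty => simpa using coeffDominated_one
  | insert a s ha ih => rw [Finset.prod_insert ha, Finset.prod_insert ha]; exact (h a).mul ih

lemma coeffDominated_X_sub_C (a : ℤ) : CoeffDominated (X - C a) (X + C |a|) := by
  intro i
  rw [coeff_sub, coeff_add, coeff_X, coeff_C, coeff_C]
  rcases Nat.lt_trichotomy i 1 with h | h | h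
  · obtain rfl : i = 0 := by omega
    simp
  · subst h; simp
  · rw [if_neg (by omega), if_neg (by omega), if_neg (by omega)]; simp

lemma sum_abs_padeBase_coeff_le {M : ℤ} (hM : ∀ j, |α j| ≤ M) (hM0 : 0 ≤ M) :
    ∑ i ∈ Finset.range ((∑ j, e j) + 1), |(padeBase α e).coeff i| * M ^ i
      ≤ (2 * M) ^ (∑ j, e j) := by
  set Q : ℤ[X] := ∏ j, (X + C |α j|) ^ e j with hQ
  have hdom : CoeffDominated (padeBase α e) Q :=
    CoeffDominated.prod _ fun j => (coeffDominated_X_sub_C _).pow _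
  have hdeg : Q.natDegree < (∑ j, e j) + 1 := by
    rw [hQ, natDegree_prod_of_monic _ _ fun j _ => (monic_X_add_C _).pow _]
    simp only [natDegree_pow, natDegree_X_add_C, mul_one]
    omega
  have hev : Q.eval M = ∑ i ∈ Finset.range ((∑ j, e j) + 1), Q.coeff i * M ^ i :=
    eval_eq_sum_range' hdeg M
  calc _ ≤ ∑ i ∈ Finset.range ((∑ j, e j) + 1), Q.coeff i * M ^ i :=
        Finset.sum_le_sum fun i _ => mul_le_mul_of_nonneg_right (hdom i) (pow_nonneg hM0 _)
    _ = ∏ j, (M + |α j|) ^ e j := by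
        rw [← hev, hQ, eval_prod]; simp only [eval_pow, eval_add, eval_X, eval_C]
    _ ≤ ∏ j, (2 * M) ^ e j := by
        refine Finset.prod_le_prod (fun j _ => ?_) fun j _ => ?_
        · exact pow_nonneg (by positivity) _
        · exact pow_le_pow_left₀ (by positivity) (by linarith [hM j]) _
    _ = _ := Finset.prod_pow_eq_pow_sum _ _ _

lemma sum_factorial_le (i : ℕ) : ∑ n ∈ Finset.range i, n ! ≤ i ! := by
  induction i with
  | zero => simp
  | succ i ih =>
    rw [Finset.sum_range_succ, Nat.factorial_succ]
    rcases Nat.eq_zero_or_pos i with rfl | hi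
    · simp
    · nlinarith [Nat.factorial_pos i]

lemma abs_padeCoeff {i : ℕ} (hi : i ≤ ∑ j, e j) :
    |padeCoeff α e i| * (i ! : ℤ) = ((∑ j, e j)! : ℤ) * |(padeBase α e).coeff i| := by
  have h := congrArg abs (padeCoeff_mul_factorial α e hi)
  rwa [abs_mul, abs_mul, Nat.abs_cast, Nat.abs_cast] at h

lemma abs_padeDen_le {M : ℤ} (hM : ∀ j, |α j| ≤ M) (hM1 : 1 ≤ M) :
    |(padeDen α e).eval 1| ≤ ((∑ j, e j)! : ℤ) * (2 * M) ^ (∑ j, e j) := by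
  unfold padeDen
  rw [eval_finsetSum]
  simp only [eval_mul, eval_C, eval_pow, eval_X, one_pow, mul_one]
  refine (Finset.abs_sum_le_sum_abs _ _).trans ?_
  refine le_trans ?_ (mul_le_mul_of_nonneg_left
    (sum_abs_padeBase_coeff_le α e hM (by omega)) (by positivity))
  rw [Finset.mul_sum]
  refine Finset.sum_le_sum fun i hi => ?_
  have hi' : i ≤ ∑ j, e j := by simpa [Nat.lt_succ_iff] using hi
  rw [← mul_assoc, ← abs_padeCoeff α e hi', mul_assoc]
  refine le_mul_of_one_le_right (abs_nonneg _) ?_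
  exact one_le_mul_of_one_le_of_one_le (by exact_mod_cast Nat.factorial_pos i)
    (one_le_pow₀ hM1)

lemma abs_padeNum_le {M : ℤ} (hM : ∀ j, |α j| ≤ M) (hM1 : 1 ≤ M) {a : ℤ} (ha : |a| ≤ M) :
    |(padeNum α e a).eval 1| ≤ ((∑ j, e j)! : ℤ) * (2 * M) ^ (∑ j, e j) := by
  unfold padeNum
  rw [eval_finsetSum]
  simp only [eval_finsetSum, eval_mul, eval_C, eval_pow, eval_X, one_pow, mul_one]
  refine (Finset.abs_sum_le_sum_abs _ _).trans ?_
  refine le_trans ?_ (mul_le_mul_of_nonneg_left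
    (sum_abs_padeBase_coeff_le α e hM (by omega)) (by positivity))
  rw [Finset.mul_sum]
  refine Finset.sum_le_sum fun i hi => ?_
  have hi' : i ≤ ∑ j, e j := by simpa [Nat.lt_succ_iff] using hi
  rw [← mul_assoc, ← abs_padeCoeff α e hi', mul_assoc, ← Finset.mul_sum, abs_mul]
  refine mul_le_mul_of_nonneg_left ?_ (abs_nonneg _)
  refine (Finset.abs_sum_le_sum_abs _ _).trans ?_
  have : ∑ n ∈ Finset.range i, |(n ! : ℤ) * a ^ n| ≤ ∑ n ∈ Finset.range i, (n ! : ℤ) * M ^ i := by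
    refine Finset.sum_le_sum fun n hn => ?_
    rw [abs_mul, Nat.abs_cast, abs_pow]
    refine mul_le_mul_of_nonneg_left ?_ (by positivity)
    exact (pow_le_pow_left₀ (abs_nonneg _) ha _).trans
      (pow_le_pow_right₀ hM1 (Finset.mem_range.1 hn).le)
  refine this.trans ?_
  rw [← Finset.sum_mul]
  refine mul_le_mul_of_nonneg_right ?_ (by positivity)
  exact_mod_cast sum_factorial_le i

section Padic

variable (p : ℕ) [Fact p.Prime]

lemma tendsto_factorial_padic :
    Tendsto (fun n : ℕ => ‖(n ! : ℚ_[p])‖) atTop (nhds 0) := by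
  rw [Metric.tendsto_atTop]
  intro ε hε
  have hp : (1 : ℝ) < p := by exact_mod_cast (Fact.out : p.Prime).one_lt
  obtain ⟨j, hj⟩ := exists_pow_lt_of_lt_one hε (inv_lt_one_of_one_lt₀ hp)
  refine ⟨p ^ j, fun n hn => ?_⟩
  have hd : p ^ j ∣ n ! := Nat.dvd_factorial (pow_pos (Fact.out : p.Prime).pos _) hn
  have := (Padic.norm_int_le_pow_iff_dvd (p := p) (n ! : ℤ) j).2 (by exact_mod_cast hd)
  rw [dist_zero_right, norm_norm]
  refine lt_of_le_of_lt ?_ hj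
  rw [zpow_neg, zpow_natCast, ← inv_pow] at this
  exact_mod_cast this

lemma summable_of_factorial (f : ℕ → ℤ) (g : ℕ → ℕ) (hg : Tendsto g atTop atTop) :
    Summable fun n : ℕ => ((g n)! : ℚ_[p]) * (f n : ℚ_[p]) := by
  refine NonarchimedeanAddGroup.summable_of_tendsto_cofinite_zero ?_
  rw [Nat.cofinite_eq_atTop]
  rw [tendsto_zero_iff_norm_tendsto_zero]
  refine squeeze_zero (fun _ => norm_nonneg _) (fun n => ?_)
    ((tendsto_factorial_padic p).comp hg)
  rw [norm_mul]
  exact mul_le_of_le_one_right (norm_nonneg _) (Padic.norm_int_le_one _)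

lemma eulerF_eq (a : ℤ) (i : ℕ) :
    eulerF p a = ((∑ n ∈ Finset.range i, (n ! : ℤ) * a ^ n : ℤ) : ℚ_[p])
      + ∑' n : ℕ, ((n + i)! : ℚ_[p]) * ((a ^ (n + i) : ℤ) : ℚ_[p]) := by
  unfold eulerF
  have hs : Summable fun n : ℕ => (n ! : ℚ_[p]) * (a : ℚ_[p]) ^ n := by
    simpa using summable_of_factorial p (fun n => a ^ n) id tendsto_id
  rw [← hs.sum_add_tsum_nat_add i]
  push_cast
  rfl

lemma pade_value (a : ℤ) :
    ((padeDen α e).eval 1 : ℤ) * eulerF p a - ((padeNum α e a).eval 1 : ℤ)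
      = ∑' n : ℕ, (padeRem α e a n : ℚ_[p]) := by
  have hR : ∀ n, (padeRem α e a n : ℚ_[p]) = ∑ i ∈ Finset.range ((∑ j, e j) + 1),
      (padeCoeff α e i : ℚ_[p]) * (((n + i)! : ℚ_[p]) * ((a ^ (n + i) : ℤ) : ℚ_[p])) := by
    intro n
    unfold padeRem
    push_cast
    rfl
  simp_rw [hR]
  rw [Summable.tsum_finsetSum fun i _ => (summable_of_factorial p (fun n => a ^ (n + i))
    (fun n => n + i) (tendsto_add_atTop_nat i)).mul_left _]
  simp_rw [tsum_mul_left]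
  unfold padeDen padeNum
  simp only [eval_finsetSum, eval_mul, eval_C, eval_pow, eval_X, one_pow, mul_one]
  rw [Int.cast_sum, Int.cast_sum, Finset.sum_mul, ← Finset.sum_sub_distrib]
  refine Finset.sum_congr rfl fun i _ => ?_
  conv_lhs => rw [eulerF_eq p a i]
  rw [← Finset.mul_sum]
  push_cast
  ring

lemma norm_pade_value_le (j : Fin k) :
    ‖((padeDen α e).eval 1 : ℤ) * eulerF p (α j) - ((padeNum α e (α j)).eval 1 : ℤ)‖
      ≤ ‖(((∑ j, e j)! * (e j)! : ℕ) : ℚ_[p])‖ := by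
  rw [pade_value]
  refine (IsUltrametricDist.norm_tsum_le _).trans (ciSup_le fun n => ?_)
  obtain ⟨c, hc⟩ := factorial_mul_dvd_padeRem α e j n
  rw [hc, Int.cast_mul, norm_mul]
  refine (mul_le_of_le_one_right (norm_nonneg _) (Padic.norm_int_le_one _)).trans (le_of_eq ?_)
  push_cast
  rfl

end Padic

end PadeBounds

section PadeDet

open Polynomial

variable {k : ℕ} (α : Fin k → ℤ) (t : ℕ)

/-- The exponents of the family of Padé approximations: all equal to `t + 1`, with one of them
lowered by one in the rows of positive index. -/
def padeExp (μ : Fin (k + 1)) (j : Fin k) : ℕ := if μ = j.succ then t else t + 1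

lemma sum_padeExp_zero : ∑ j, padeExp (k := k) t 0 j = k * (t + 1) := by
  have : ∀ j : Fin k, padeExp t 0 j = t + 1 := fun j =>
    if_neg (Fin.succ_ne_zero j).symm
  simp [this]

lemma sum_padeExp_succ (i : Fin k) : (∑ j, padeExp (k := k) t i.succ j) + 1 = k * (t + 1) := by
  have h : ∀ j : Fin k, padeExp t i.succ j + (if i = j then 1 else 0) = t + 1 := by
    intro j
    unfold padeExp
    simp only [Fin.succ_inj]
    split_ifs <;> rfl
  have : ∑ j, (padeExp t i.succ j + (if i = j then 1 else 0)) = k * (t + 1) := by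
    simp [h]
  rw [Finset.sum_add_distrib] at this
  simpa using this

lemma sum_padeExp_le (μ : Fin (k + 1)) : ∑ j, padeExp t μ j ≤ k * (t + 1) := by
  refine Fin.cases ?_ (fun i => ?_) μ
  · exact (sum_padeExp_zero t).le
  · have := sum_padeExp_succ (k := k) t i; omega

lemma le_sum_padeExp (μ : Fin (k + 1)) : k * (t + 1) - 1 ≤ ∑ j, padeExp t μ j := by
  refine Fin.cases ?_ (fun i => ?_) μ
  · have := (sum_padeExp_zero (k := k) t); omega
  · have := sum_padeExp_succ (k := k) t i; omega

lemma le_padeExp (μ : Fin (k + 1)) (j : Fin k) : t ≤ padeExp t μ j := by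
  unfold padeExp; split_ifs <;> omega

/-- The matrix of the polynomials in the Padé approximations. -/
def padeMatrix : Matrix (Fin (k + 1)) (Fin (k + 1)) ℤ[X] := fun μ =>
  Fin.cons (padeDen α (padeExp t μ)) fun j => padeNum α (padeExp t μ) (α j)

/-- The matrix of denominators and reduced remainders. -/
def padeRemMatrix : Matrix (Fin (k + 1)) (Fin (k + 1)) (PowerSeries ℤ) := fun μ =>
  Fin.cons (padeDen α (padeExp t μ) : PowerSeries ℤ) fun j =>
    PowerSeries.mk fun n => padeRem α (padeExp t μ) (α j)
      (n + (k * (t + 1) + t - 1 - ∑ j, padeExp t μ j))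

/-- The column operations relating the two matrices. -/
def padeColumnOps : Matrix (Fin (k + 1)) (Fin (k + 1)) (PowerSeries ℤ) := fun i j =>
  if i = 0 then (Fin.cons 1 (fun j => factSeries (α j)) : Fin (k + 1) → PowerSeries ℤ) j
  else if i = j then -PowerSeries.X ^ (k * (t + 1) + t - 1) else 0

lemma padeMatrix_factor (hk : 1 ≤ k) (ht : 1 ≤ t) :
    (padeMatrix α t).map (coeToPowerSeries.ringHom : ℤ[X] →+* PowerSeries ℤ)
      = padeRemMatrix α t * padeColumnOps α t := by
  ext1 μ j
  rw [Matrix.mul_apply, Fin.sum_univ_succ]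
  refine Fin.cases ?_ (fun j => ?_) j
  · rw [Finset.sum_eq_zero]
    · simp [padeMatrix, padeRemMatrix, padeColumnOps]
    · intro i _
      simp [padeColumnOps, Fin.succ_ne_zero]
  · rw [Finset.sum_eq_single j]
    · simp only [padeMatrix, padeRemMatrix, padeColumnOps, Matrix.map_apply, Fin.cons_zero,
        Fin.cons_succ, if_true, Fin.succ_ne_zero, if_false, coeToPowerSeries.ringHom_apply]
      have h := pade_identity α (padeExp t μ) (α j)
      set L := ∑ j, padeExp t μ j with hL
      have hL1 : L ≤ k * (t + 1) := sum_padeExp_le t μ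
      have hs : PowerSeries.X ^ (k * (t + 1) + t - 1) * (PowerSeries.mk fun n =>
          padeRem α (padeExp t μ) (α j) (n + (k * (t + 1) + t - 1 - L)))
          = PowerSeries.X ^ L * PowerSeries.mk (padeRem α (padeExp t μ) (α j)) := by
        ext n
        rw [PowerSeries.coeff_X_pow_mul', PowerSeries.coeff_X_pow_mul']
        have hk1 : t + 1 ≤ k * (t + 1) := Nat.le_mul_of_pos_left _ hk
        have h2 := le_padeExp t μ j
        have h3 := le_sum_padeExp t μ
        by_cases hn : k * (t + 1) + t - 1 ≤ n
        · rw [if_pos hn, if_pos (by omega), PowerSeries.coeff_mk, PowerSeries.coeff_mk]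
          congr 1
          omega
        · rw [if_neg hn]
          split_ifs with hn'
          · rw [PowerSeries.coeff_mk, padeRem_eq_zero]
            rw [← hL] at h3
            omega
          · rfl
      linear_combination hs - h
    · intro i _ hij
      simp [padeColumnOps, Fin.succ_ne_zero, hij]
    · simp

lemma det_padeColumnOps :
    (padeColumnOps α t).det = (-PowerSeries.X ^ (k * (t + 1) + t - 1)) ^ k := by
  rw [Matrix.det_of_isUpperTriangular]
  · rw [Fin.prod_univ_succ]
    simp [padeColumnOps, Fin.succ_ne_zero]
  · intro i j hij
    simp only [id] at hij
    have h0 : i ≠ 0 := fun h => by subst h; exact absurd hij (Fin.not_lt_zero j)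
    simp [padeColumnOps, h0, hij.ne']

lemma constantCoeff_det_padeRemMatrix_ne_zero (hk : 1 ≤ k) (ht : 1 ≤ t) (hα : ∀ j, α j ≠ 0)
    (hinj : Function.Injective α) :
    PowerSeries.constantCoeff (padeRemMatrix α t).det ≠ 0 := by
  have hk1 : t + 1 ≤ k * (t + 1) := Nat.le_mul_of_pos_left _ hk
  rw [RingHom.map_det, Matrix.det_of_isLowerTriangular]
  · rw [Finset.prod_ne_zero_iff]
    intro i _
    refine Fin.cases ?_ (fun i => ?_) i
    · have : PowerSeries.constantCoeff (padeDen α (padeExp t 0) : PowerSeries ℤ) = 1 := by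
        rw [← PowerSeries.coeff_zero_eq_constantCoeff_apply, Polynomial.coeff_coe]
        unfold padeDen
        rw [finsetSum_coeff, Finset.sum_eq_single (∑ j, padeExp t 0 j)]
        · rw [padeCoeff_top]; simp
        · intro b hb hb'
          have : b < (∑ j, padeExp (k := k) t 0 j) + 1 := by simpa using hb
          rw [coeff_C_mul, coeff_X_pow, if_neg (by omega), mul_zero]
        · intro h
          simp at h
      simp [padeRemMatrix, this]
    · have h := padeRem_ne_zero α (padeExp t i.succ) hα hinj i
      have h1 : padeExp t i.succ i = t := if_pos rfl
      rw [h1] at h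
      have h2 := sum_padeExp_succ (k := k) t i
      have h3 : k * (t + 1) + t - 1 - ∑ j, padeExp t i.succ j = t := by omega
      simpa [padeRemMatrix, ← PowerSeries.coeff_zero_eq_constantCoeff_apply, h3] using h
  · intro i j hij
    have hij : i < j := hij
    obtain ⟨j, rfl⟩ : ∃ j', j = Fin.succ j' :=
      Fin.exists_succ_eq.2 (fun h => by subst h; exact absurd hij (Fin.not_lt_zero i)) |>.imp
        fun _ h => h.symm
    have h1 : padeExp t i j = t + 1 := if_neg hij.ne
    have h2 := le_sum_padeExp t i
    have h3 : padeRem α (padeExp t i) (α j) (k * (t + 1) + t - 1 - ∑ j, padeExp t i j) = 0 := by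
      refine padeRem_eq_zero _ _ _ ?_
      omega
    simpa [padeRemMatrix, ← PowerSeries.coeff_zero_eq_constantCoeff_apply] using h3

lemma padeDen_natDegree_le (e : Fin k → ℕ) : (padeDen α e).natDegree ≤ ∑ j, e j := by
  refine natDegree_sum_le_of_forall_le _ _ fun i _ => ?_
  exact (natDegree_C_mul_X_pow_le _ _).trans (Nat.sub_le _ _)

lemma padeNum_natDegree_le (e : Fin k → ℕ) (a : ℤ) :
    (padeNum α e a).natDegree ≤ (∑ j, e j) - 1 := by
  refine natDegree_sum_le_of_forall_le _ _ fun i hi => ?_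
  refine natDegree_sum_le_of_forall_le _ _ fun n hn => ?_
  refine (natDegree_C_mul_X_pow_le _ _).trans ?_
  rw [Finset.mem_range] at hi hn
  omega

lemma sum_sum_padeExp :
    (∑ μ, ∑ j, padeExp (k := k) t μ j) + k = (k + 1) * (k * (t + 1)) := by
  rw [Fin.sum_univ_succ, sum_padeExp_zero]
  have : ∑ i : Fin k, ((∑ j, padeExp t i.succ j) + 1) = k * (k * (t + 1)) := by
    simp [sum_padeExp_succ]
  rw [Finset.sum_add_distrib] at this
  simp at this
  linarith

lemma natDegree_det_padeMatrix_le (hk : 1 ≤ k) (ht : 1 ≤ t) :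
    (padeMatrix α t).det.natDegree ≤ (k * (t + 1) + t - 1) * k := by
  have hk1 : t + 1 ≤ k * (t + 1) := Nat.le_mul_of_pos_left _ hk
  rw [Matrix.det_apply]
  refine natDegree_sum_le_of_forall_le _ _ fun σ _ => ?_
  refine (natDegree_smul_le _ _).trans ?_
  refine (natDegree_prod_le _ _).trans ?_
  have h : ∀ i, (padeMatrix α t (σ i) i).natDegree + (if i = 0 then 0 else 1)
      ≤ ∑ j, padeExp t (σ i) j := by
    intro i
    refine Fin.cases ?_ (fun i => ?_) i
    · simpa [padeMatrix] using padeDen_natDegree_le α (padeExp t (σ 0))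
    · have h1 := padeNum_natDegree_le α (padeExp t (σ i.succ)) (α i)
      have h2 := le_sum_padeExp t (σ i.succ)
      simp only [padeMatrix, Fin.cons_succ, Fin.succ_ne_zero, if_false]
      omega
  have h2 := Finset.sum_le_sum fun i (_ : i ∈ Finset.univ) => h i
  rw [Finset.sum_add_distrib, Equiv.sum_comp σ (fun μ => ∑ j, padeExp t μ j)] at h2
  have h3 : ∑ i : Fin (k + 1), (if i = 0 then 0 else 1) = k := by
    rw [Fin.sum_univ_succ]; simp [Fin.succ_ne_zero]
  rw [h3] at h2
  have h4 := sum_sum_padeExp (k := k) t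
  obtain ⟨u, rfl⟩ : ∃ u, t = u + 1 := ⟨t - 1, by omega⟩
  have h5 : k * (u + 1 + 1) + (u + 1) - 1 = k * (u + 2) + u := by ring_nf; omega
  rw [h5]
  nlinarith

lemma eval_det_padeMatrix_ne_zero (hk : 1 ≤ k) (ht : 1 ≤ t) (hα : ∀ j, α j ≠ 0)
    (hinj : Function.Injective α) : (padeMatrix α t).det.eval 1 ≠ 0 := by
  set K := (k * (t + 1) + t - 1) * k with hK
  have h1 := congrArg Matrix.det (padeMatrix_factor α t hk ht)
  rw [Matrix.det_mul, det_padeColumnOps] at h1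
  change ((coeToPowerSeries.ringHom : ℤ[X] →+* PowerSeries ℤ).mapMatrix (padeMatrix α t)).det
    = _ at h1
  rw [← RingHom.map_det, coeToPowerSeries.ringHom_apply, neg_pow, ← pow_mul, ← hK] at h1
  have hcoeff : ∀ n, (padeMatrix α t).det.coeff n = PowerSeries.coeff n
      (PowerSeries.X ^ K * ((-1) ^ k * (padeRemMatrix α t).det)) := by
    intro n
    rw [← Polynomial.coeff_coe, h1]
    congr 1
    ring
  have hlow : ∀ n, n ≠ K → (padeMatrix α t).det.coeff n = 0 := by
    intro n hn
    rcases lt_or_gt_of_ne hn with h | h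
    · rw [hcoeff, PowerSeries.coeff_X_pow_mul', if_neg (by omega)]
    · exact coeff_eq_zero_of_natDegree_lt
        (lt_of_le_of_lt (natDegree_det_padeMatrix_le α t hk ht) h)
  have hK0 : (padeMatrix α t).det.coeff K ≠ 0 := by
    rw [hcoeff, PowerSeries.coeff_X_pow_mul', if_pos le_rfl, Nat.sub_self,
      PowerSeries.coeff_zero_eq_constantCoeff_apply, map_mul]
    refine mul_ne_zero ?_ (constantCoeff_det_padeRemMatrix_ne_zero α t hk ht hα hinj)
    rw [map_pow, map_neg, map_one]
    exact pow_ne_zero _ (by norm_num)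
  rw [eval_eq_sum_range' (n := K + 1)
    (Nat.lt_succ_of_le (natDegree_det_padeMatrix_le α t hk ht)), Finset.sum_eq_single K]
  · simpa using hK0
  · intro b _ hb
    rw [hlow b hb, zero_mul]
  · simp

/-- Simultaneous Padé approximation: an integer `W ≠ 0` of controlled size that is `p`-adically
close to a multiple of the given linear form, for every prime `p`. -/
theorem exists_pade_approximation (hk : 1 ≤ k) {l : ℕ} (hl : 2 ≤ l) (hα : ∀ j, α j ≠ 0)
    (hinj : Function.Injective α) (lam : Fin (k + 1) → ℤ) (hlam : ∃ i, lam i ≠ 0)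
    (H : ℝ) (hH : ∀ i, (|lam i| : ℝ) ≤ H) :
    ∃ B₀ W : ℤ, W ≠ 0 ∧
      (|W| : ℝ) ≤ (k + 1) * H * ((k * l)! * (2 * (maxAbs α : ℝ)) ^ (k * l)) ∧
      ∀ (p : ℕ) (_ : Fact p.Prime),
        ‖(B₀ : ℚ_[p]) * ((lam 0 : ℚ_[p]) + ∑ j : Fin k, (lam j.succ : ℚ_[p]) * eulerF p (α j))
          - (W : ℚ_[p])‖ ≤ ‖(((k * l - 1)! * (l - 1)! : ℕ) : ℚ_[p])‖ := by
  obtain ⟨t, rfl⟩ : ∃ t, l = t + 1 := ⟨l - 1, by omega⟩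
  have ht : 1 ≤ t := by omega
  set M : Matrix (Fin (k + 1)) (Fin (k + 1)) ℤ :=
    (padeMatrix α t).map (fun P => P.eval 1) with hM
  have hdet : M.det ≠ 0 := by
    have := eval_det_padeMatrix_ne_zero α t hk ht hα hinj
    rw [← coe_evalRingHom, RingHom.map_det] at this
    exact this
  obtain ⟨μ, hμ⟩ : ∃ μ, (M.mulVec lam) μ ≠ 0 := by
    by_contra hcon
    push Not at hcon
    obtain ⟨i, hi⟩ := hlam
    have := Matrix.eq_zero_of_mulVec_eq_zero hdet (funext hcon : M.mulVec lam = 0)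
    exact hi (by rw [this]; rfl)
  have hmv : (M.mulVec lam) μ = (padeDen α (padeExp t μ)).eval 1 * lam 0
      + ∑ j : Fin k, (padeNum α (padeExp t μ) (α j)).eval 1 * lam j.succ := by
    simp [Matrix.mulVec, dotProduct, Fin.sum_univ_succ, hM, padeMatrix]
  have hle : ∀ j, |α j| ≤ (maxAbs α : ℤ) := fun j => by
    rw [Int.abs_eq_natAbs]
    exact_mod_cast Finset.le_sup (f := fun j => (α j).natAbs) (Finset.mem_univ j)
  have h1 : (1 : ℤ) ≤ maxAbs α :=
    (Int.one_le_abs (hα ⟨0, hk⟩)).trans (hle _)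
  have hfac : (((∑ j, padeExp t μ j)! : ℤ) * (2 * (maxAbs α : ℤ)) ^ (∑ j, padeExp t μ j))
      ≤ ((k * (t + 1))! : ℤ) * (2 * (maxAbs α : ℤ)) ^ (k * (t + 1)) := by
    refine mul_le_mul ?_ ?_ (by positivity) (by positivity)
    · exact_mod_cast Nat.factorial_le (sum_padeExp_le t μ)
    · exact pow_le_pow_right₀ (by linarith) (sum_padeExp_le t μ)
  set T : ℤ := ((k * (t + 1))! : ℤ) * (2 * (maxAbs α : ℤ)) ^ (k * (t + 1)) with hT
  have hT0 : 0 ≤ T := by positivity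
  refine ⟨(padeDen α (padeExp t μ)).eval 1, (M.mulVec lam) μ, hμ, ?_, ?_⟩
  · have hTR : ((k * (t + 1))! * (2 * (maxAbs α : ℝ)) ^ (k * (t + 1))) = (T : ℝ) := by
      rw [hT]; push_cast; rfl
    rw [hTR, hmv]
    have hA : (|((padeDen α (padeExp t μ)).eval 1 : ℤ)| : ℝ) ≤ T := by
      exact_mod_cast (abs_padeDen_le α (padeExp t μ) hle h1).trans hfac
    have hB : ∀ j, (|((padeNum α (padeExp t μ) (α j)).eval 1 : ℤ)| : ℝ) ≤ T := fun j => by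
      exact_mod_cast (abs_padeNum_le α (padeExp t μ) hle h1 (hle j)).trans hfac
    have hT0' : (0 : ℝ) ≤ T := by exact_mod_cast hT0
    have hmul : ∀ (a : ℤ) (i : Fin (k + 1)), (|a| : ℝ) ≤ T → |(a * lam i : ℝ)| ≤ T * H := by
      intro a i ha
      rw [abs_mul]
      exact mul_le_mul ha (hH i) (abs_nonneg _) hT0'
    push_cast
    refine (abs_add_le _ _).trans ?_
    refine (add_le_add (hmul _ _ hA) ((Finset.abs_sum_le_sum_abs _ _).trans
      (Finset.sum_le_sum fun j _ => hmul _ j.succ (hB j)))).trans (le_of_eq ?_)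
    simp
    ring
  · intro p _
    rw [hmv]
    have : ((padeDen α (padeExp t μ)).eval 1 : ℤ) *
        ((lam 0 : ℚ_[p]) + ∑ j : Fin k, (lam j.succ : ℚ_[p]) * eulerF p (α j))
        - (((padeDen α (padeExp t μ)).eval 1 * lam 0
          + ∑ j : Fin k, (padeNum α (padeExp t μ) (α j)).eval 1 * lam j.succ : ℤ) : ℚ_[p])
        = ∑ j : Fin k, (lam j.succ : ℚ_[p]) * (((padeDen α (padeExp t μ)).eval 1 : ℤ) *
          eulerF p (α j) - ((padeNum α (padeExp t μ) (α j)).eval 1 : ℤ)) := by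
      push_cast
      rw [mul_add, Finset.mul_sum, add_sub_add_left_eq_sub, ← Finset.sum_sub_distrib]
      refine Finset.sum_congr rfl fun j _ => ?_
      ring
    rw [this]
    refine IsUltrametricDist.norm_sum_le_of_forall_le_of_nonneg (norm_nonneg _) fun j _ => ?_
    rw [norm_mul]
    refine (mul_le_of_le_one_left (norm_nonneg _) (Padic.norm_int_le_one _)).trans ?_
    refine (norm_pade_value_le α (padeExp t μ) p j).trans ?_
    have hdvd : (k * (t + 1) - 1)! * (t + 1 - 1)! ∣
        (∑ j, padeExp t μ j)! * (padeExp t μ j)! :=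
      mul_dvd_mul (Nat.factorial_dvd_factorial (le_sum_padeExp t μ))
        (Nat.factorial_dvd_factorial (le_padeExp t μ j))
    obtain ⟨c, hc⟩ := hdvd
    rw [hc, Nat.cast_mul, norm_mul]
    exact mul_le_of_le_one_right (norm_nonneg _) (Padic.norm_int_le_one c)

end PadeDet

/-! ### Elementary estimates for the von Mangoldt function -/

section Mangoldt

open ArithmeticFunction hiding log

/-- Chebyshev's function at natural numbers. -/
def psiNat (n : ℕ) : ℝ := ∑ d ∈ Finset.Ioc 0 n, Λ d

lemma psiNat_succ (n : ℕ) : psiNat (n + 1) = psiNat n + Λ (n + 1) := by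
  unfold psiNat
  rw [Finset.sum_Ioc_succ_top (Nat.zero_le n)]

lemma psiNat_nonneg (n : ℕ) : 0 ≤ psiNat n := Finset.sum_nonneg fun _ _ => vonMangoldt_nonneg

lemma log_factorial_eq_sum {n N : ℕ} (h : n ≤ N) :
    Real.log (n ! : ℝ) = ∑ d ∈ Finset.Ioc 0 N, Λ d * ((n / d : ℕ) : ℝ) := by
  have h1 := sum_Ioc_mul_zeta_eq_sum (R := ℝ) (Λ) n
  rw [vonMangoldt_mul_zeta] at h1
  have h2 : Real.log (n ! : ℝ) = ∑ i ∈ Finset.Ioc 0 n, Real.log i := by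
    clear h1 h
    induction n with
    | zero => simp
    | succ n ih =>
      rw [Finset.sum_Ioc_succ_top (Nat.zero_le n), ← ih, Nat.factorial_succ, Nat.cast_mul,
        Real.log_mul (by positivity) (by positivity), add_comm]
  rw [h2]
  have h3 : ∑ i ∈ Finset.Ioc 0 n, Real.log i
      = ∑ d ∈ Finset.Ioc 0 n, Λ d * ((n / d : ℕ) : ℝ) := by
    simpa [ArithmeticFunction.log_apply] using h1
  rw [h3]
  refine Finset.sum_subset (Finset.Ioc_subset_Ioc_right h) fun d hd hd' => ?_
  simp only [Finset.mem_Ioc] at hd hd'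
  rw [Nat.div_eq_of_lt (by omega)]
  simp

lemma psiNat_sub_le_log_choose {n a b : ℕ} (h : a + b = n) (hab : a ≤ b) :
    psiNat n - psiNat b ≤ Real.log (n.choose a : ℝ) := by
  have hc : ((n.choose a : ℕ) : ℝ) * (a ! : ℝ) * (b ! : ℝ) = (n ! : ℝ) := by
    have := Nat.choose_mul_factorial_mul_factorial (show a ≤ n by omega)
    rw [show n - a = b by omega] at this
    exact_mod_cast this
  have hpos : (0 : ℝ) < n.choose a := by exact_mod_cast Nat.choose_pos (by omega)
  have h1 : Real.log (n.choose a : ℝ) = Real.log (n ! : ℝ) - Real.log (a ! : ℝ)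
      - Real.log (b ! : ℝ) := by
    rw [← hc, Real.log_mul (by positivity) (by positivity),
      Real.log_mul hpos.ne' (by positivity)]
    ring
  rw [h1, log_factorial_eq_sum le_rfl, log_factorial_eq_sum (show a ≤ n by omega),
    log_factorial_eq_sum (show b ≤ n by omega), ← Finset.sum_sub_distrib,
    ← Finset.sum_sub_distrib]
  have h2 : psiNat n - psiNat b = ∑ d ∈ Finset.Ioc 0 n, if b < d then Λ d else 0 := by
    unfold psiNat
    rw [← Finset.sum_filter, ← Finset.sum_sdiff (Finset.Ioc_subset_Ioc_right
      (show b ≤ n by omega)), add_sub_cancel_right]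
    refine Finset.sum_congr ?_ fun _ _ => rfl
    ext d
    simp only [Finset.mem_sdiff, Finset.mem_Ioc, Finset.mem_filter]
    omega
  rw [h2]
  refine Finset.sum_le_sum fun d hd => ?_
  have hd0 : 0 < d := (Finset.mem_Ioc.1 hd).1
  have hdn : d ≤ n := (Finset.mem_Ioc.1 hd).2
  have h3 : a / d + b / d ≤ n / d := by rw [← h]; exact Nat.div_add_div_le_add_div
  rw [← mul_sub, ← mul_sub]
  split_ifs with hbd
  · rw [Nat.div_eq_of_lt hbd, Nat.div_eq_of_lt (by omega : a < d)]
    have : 1 ≤ n / d := (Nat.one_le_div_iff hd0).2 hdn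
    have : (1 : ℝ) ≤ (n / d : ℕ) := by exact_mod_cast this
    refine le_mul_of_one_le_right vonMangoldt_nonneg ?_
    simpa using this
  · refine mul_nonneg vonMangoldt_nonneg ?_
    have : ((a / d : ℕ) : ℝ) + (b / d : ℕ) ≤ (n / d : ℕ) := by exact_mod_cast h3
    linarith

lemma psiNat_le (n : ℕ) : psiNat n ≤ Real.log 4 * n := by
  have hl4 : 0 ≤ Real.log 4 := Real.log_nonneg (by norm_num)
  induction n using Nat.strong_induction_on with
  | _ n ih =>
    rcases Nat.lt_or_ge n 2 with h2 | h2
    · interval_cases n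
      · simp [psiNat]
      · simpa [psiNat] using hl4
    · obtain ⟨a, rfl | rfl⟩ := Nat.even_or_odd' n
      · have h1 := psiNat_sub_le_log_choose (n := 2 * a) (a := a) (b := a) (by omega) le_rfl
        have h3 := ih a (by omega)
        have h4 : Real.log ((2 * a).choose a : ℝ) ≤ a * Real.log 4 := by
          rw [← Real.log_pow]
          refine Real.log_le_log (by exact_mod_cast Nat.choose_pos (by omega)) ?_
          exact_mod_cast Nat.centralBinom_le_four_pow a
        push_cast
        linarith
      · have h1 := psiNat_sub_le_log_choose (n := 2 * a + 1) (a := a) (b := a + 1) (by omega)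
          (by omega)
        have h3 := ih (a + 1) (by omega)
        have h4 : Real.log ((2 * a + 1).choose a : ℝ) ≤ a * Real.log 4 := by
          rw [← Real.log_pow]
          refine Real.log_le_log (by exact_mod_cast Nat.choose_pos (by omega)) ?_
          exact_mod_cast Nat.choose_middle_le_pow a
        push_cast at h3 ⊢
        linarith

lemma log_factorial_le (n : ℕ) : Real.log (n ! : ℝ) ≤ n * Real.log n := by
  rw [← Real.log_pow]
  refine Real.log_le_log (by positivity) ?_
  exact_mod_cast Nat.factorial_le_pow n

lemma le_log_factorial (n : ℕ) : n * Real.log n - n ≤ Real.log (n ! : ℝ) := by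
  rcases Nat.eq_zero_or_pos n with rfl | hn
  · simp
  have hn' : (0 : ℝ) < n := by exact_mod_cast hn
  have h := Real.pow_div_factorial_le_exp (n : ℝ) hn'.le n
  have h2 := Real.log_le_log (by positivity) h
  rw [Real.log_exp, Real.log_div (by positivity) (by positivity), Real.log_pow] at h2
  linarith

lemma log_le_sum_vonMangoldt_div {N : ℕ} (hN : 1 ≤ N) :
    Real.log N - 1 ≤ ∑ d ∈ Finset.Ioc 0 N, Λ d / d := by
  have hN' : (0 : ℝ) < N := by exact_mod_cast hN
  have h1 := le_log_factorial N
  rw [log_factorial_eq_sum le_rfl] at h1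
  have h2 : ∑ d ∈ Finset.Ioc 0 N, Λ d * ((N / d : ℕ) : ℝ) ≤ N * ∑ d ∈ Finset.Ioc 0 N, Λ d / d := by
    rw [Finset.mul_sum]
    refine Finset.sum_le_sum fun d _ => ?_
    refine (mul_le_mul_of_nonneg_left Nat.cast_div_le vonMangoldt_nonneg).trans (le_of_eq ?_)
    ring
  have h3 := h1.trans h2
  have h4 : N * (Real.log N - 1) ≤ N * ∑ d ∈ Finset.Ioc 0 N, Λ d / d := by linarith
  exact le_of_mul_le_mul_left h4 hN'

lemma sum_vonMangoldt_div_le {N : ℕ} (hN : 1 ≤ N) :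
    ∑ d ∈ Finset.Ioc 0 N, Λ d / d ≤ Real.log N + Real.log 4 := by
  have hN' : (0 : ℝ) < N := by exact_mod_cast hN
  have h1 := log_factorial_le N
  rw [log_factorial_eq_sum le_rfl] at h1
  have h2 : N * ∑ d ∈ Finset.Ioc 0 N, Λ d / d - psiNat N
      ≤ ∑ d ∈ Finset.Ioc 0 N, Λ d * ((N / d : ℕ) : ℝ) := by
    unfold psiNat
    rw [Finset.mul_sum, ← Finset.sum_sub_distrib]
    refine Finset.sum_le_sum fun d hd => ?_
    have hd0 : 0 < d := (Finset.mem_Ioc.1 hd).1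
    have hd0' : (0 : ℝ) < d := by exact_mod_cast hd0
    have h5 : (N : ℝ) / d ≤ (N / d : ℕ) + 1 := by
      rw [div_le_iff₀ hd0']
      have := Nat.lt_div_mul_add (a := N) hd0
      have : (N : ℝ) < (N / d : ℕ) * d + d := by exact_mod_cast this
      linarith
    have h6 := mul_le_mul_of_nonneg_left h5 (vonMangoldt_nonneg (n := d))
    have h7 : (N : ℝ) * (Λ d / d) = Λ d * (N / d) := by ring
    rw [h7]
    linarith
  have h3 := psiNat_le N
  have h4 : N * ∑ d ∈ Finset.Ioc 0 N, Λ d / d ≤ N * (Real.log N + Real.log 4) := by linarith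
  exact le_of_mul_le_mul_left h4 hN'

/-- Partial summation against an antitone function. -/
lemma sum_vonMangoldt_mul_le {f : ℕ → ℝ} {N : ℕ} (hf0 : ∀ n, 0 ≤ f n)
    (hf : ∀ n, N < n → f (n + 1) ≤ f n) {M : ℕ} (hM : N ≤ M) :
    ∑ n ∈ Finset.Ioc N M, Λ n * f n
      ≤ Real.log 4 * (N * f (N + 1) + ∑ n ∈ Finset.Ioc N M, f n) := by
  have key : ∑ n ∈ Finset.Ioc N M, Λ n * f n
      ≤ Real.log 4 * (N * f (N + 1) + ∑ n ∈ Finset.Ioc N M, f n)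
        - (Real.log 4 * M - psiNat M) * f (M + 1) := by
    induction M, hM using Nat.le_induction with
    | base =>
      have := mul_nonneg (psiNat_nonneg N) (hf0 (N + 1))
      simp only [Finset.Ioc_self, Finset.sum_empty]
      linarith
    | succ M hM ih =>
      rw [Finset.sum_Ioc_succ_top hM, Finset.sum_Ioc_succ_top hM]
      have h1 := psiNat_le (M + 1)
      have h2 := hf (M + 1) (by omega)
      have h3 := mul_le_mul_of_nonneg_left h2 (sub_nonneg.2 h1)
      rw [psiNat_succ] at h3 ⊢
      push_cast at h3 ⊢
      linarith
  have := mul_nonneg (sub_nonneg.2 (psiNat_le M)) (hf0 (M + 1))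
  linarith

end Mangoldt

section MangoldtPrimePowers

open ArithmeticFunction hiding log

lemma log_div_mul_pred_le {n : ℕ} (hn : 1 ≤ n) :
    Real.log (n + 1 : ℕ) / ((n + 1 : ℕ) * (n : ℝ))
      ≤ (Real.log n + 2) / n - (Real.log (n + 1 : ℕ) + 2) / (n + 1 : ℕ) := by
  have hn0 : (1 : ℝ) ≤ n := by exact_mod_cast hn
  have h1 : Real.log (n + 1 : ℕ) - Real.log n ≤ 1 / n := by
    rw [← Real.log_div (by positivity) (by positivity)]
    refine (Real.log_le_sub_one_of_pos (by positivity)).trans (le_of_eq ?_)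
    push_cast
    field_simp
    ring
  have h2 : (1 + (n : ℝ)) * (1 / n) ≤ 2 := by
    rw [mul_one_div, div_le_iff₀ (by linarith)]
    linarith
  have h3 := mul_le_mul_of_nonneg_left h1 (by linarith : (0 : ℝ) ≤ 1 + n)
  rw [div_sub_div _ _ (by positivity) (by positivity), div_le_div_iff₀ (by positivity)
    (by positivity)]
  push_cast at *
  have h4 : Real.log (n + 1) ≤ (Real.log n + 2) * (n + 1) - n * (Real.log (n + 1) + 2) := by
    linarith
  have := mul_le_mul_of_nonneg_right h4 (by positivity : (0 : ℝ) ≤ n * (n + 1))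
  linarith

lemma sum_log_div_mul_pred_le (N : ℕ) :
    ∑ n ∈ Finset.Icc 2 N, Real.log n / (n * ((n : ℝ) - 1)) ≤ 2 := by
  rcases Nat.lt_or_ge N 1 with h | h
  · rw [Finset.Icc_eq_empty (by omega)]; simp
  have key : ∑ n ∈ Finset.Icc 2 N, Real.log n / (n * ((n : ℝ) - 1))
      ≤ 2 - (Real.log N + 2) / N := by
    induction N, h using Nat.le_induction with
    | base => simp
    | succ N hN ih =>
      rw [Finset.sum_Icc_succ_top (by omega)]
      have := log_div_mul_pred_le hN
      have h2 : ((N + 1 : ℕ) : ℝ) - 1 = N := by push_cast; ring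
      rw [h2]
      linarith
  have h1 : 0 ≤ Real.log N := Real.log_natCast_nonneg N
  have : 0 ≤ (Real.log N + 2) / N := by positivity
  linarith

lemma sum_vonMangoldt_not_prime_le (N : ℕ) :
    ∑ n ∈ Finset.Ioc 0 N with ¬ n.Prime, Λ n / n ≤ 2 := by
  classical
  have h1 : ∑ n ∈ Finset.Ioc 0 N with ¬ n.Prime, Λ n / n
      ≤ ∑ n ∈ (Finset.Icc 2 N ×ˢ Finset.Icc 2 N).image (fun x => x.1 ^ x.2), Λ n / n := by
    rw [← Finset.sum_filter_ne_zero]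
    refine Finset.sum_le_sum_of_subset_of_nonneg (fun n hn' => ?_) fun n _ _ =>
      div_nonneg vonMangoldt_nonneg (Nat.cast_nonneg _)
    obtain ⟨hn, hne⟩ := Finset.mem_filter.1 hn'
    have hpp : IsPrimePow n := by
      rw [← vonMangoldt_ne_zero_iff]
      intro h
      exact hne (by rw [h, zero_div])
    obtain ⟨p, j, hp, hj, rfl⟩ := (isPrimePow_nat_iff n).1 hpp
    simp only [Finset.mem_filter, Finset.mem_Ioc] at hn
    have hj2 : 2 ≤ j := by
      by_contra hcon
      obtain rfl : j = 1 := by omega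
      exact hn.2 (by simpa using hp)
    have h3 : p ≤ p ^ j := Nat.le_self_pow (by omega) p
    have h4 : j < p ^ j := Nat.lt_pow_self hp.one_lt
    refine Finset.mem_image.2 ⟨(p, j), ?_, rfl⟩
    simp only [Finset.mem_product, Finset.mem_Icc]
    exact ⟨⟨hp.two_le, by omega⟩, hj2, by omega⟩
  refine h1.trans ((Finset.sum_image_le_of_nonneg fun x _ => ?_).trans ?_)
  · exact div_nonneg vonMangoldt_nonneg (Nat.cast_nonneg _)
  rw [Finset.sum_product]
  refine le_trans (Finset.sum_le_sum fun p hp => ?_) (sum_log_div_mul_pred_le N)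
  have hp2 : (2 : ℝ) ≤ p := by exact_mod_cast (Finset.mem_Icc.1 hp).1
  have h2 : ∀ j ∈ Finset.Icc 2 N, Λ (p ^ j) / ((p ^ j : ℕ) : ℝ) ≤ Real.log p * (p : ℝ)⁻¹ ^ j := by
    intro j hj
    rw [vonMangoldt_apply_pow (by have := (Finset.mem_Icc.1 hj).1; omega), div_eq_mul_inv]
    push_cast
    rw [inv_pow]
    exact mul_le_mul_of_nonneg_right vonMangoldt_le_log (by positivity)
  refine (Finset.sum_le_sum h2).trans ?_
  rw [← Finset.mul_sum]
  have h3 : ∑ j ∈ Finset.Icc 2 N, (p : ℝ)⁻¹ ^ j ≤ (p : ℝ)⁻¹ ^ 2 / (1 - (p : ℝ)⁻¹) := by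
    have : Finset.Icc 2 N = Finset.Ico 2 (N + 1) := by ext; simp
    rw [this]
    exact geom_sum_Ico_le_of_lt_one (by positivity) (inv_lt_one_of_one_lt₀ (by linarith))
  refine (mul_le_mul_of_nonneg_left h3 (Real.log_natCast_nonneg p)).trans (le_of_eq ?_)
  have : (p : ℝ) - 1 ≠ 0 := by linarith
  field_simp

lemma rpow_neg_one_sub_le {n : ℕ} (hn : 2 ≤ n) {σ : ℝ} (hσ : 0 < σ) :
    (n : ℝ) ^ (-1 - σ) ≤ (((n : ℝ) - 1) ^ (-σ) - (n : ℝ) ^ (-σ)) / σ := by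
  have hn' : (2 : ℝ) ≤ n := by exact_mod_cast hn
  have h0 : 0 < 1 - (n : ℝ)⁻¹ := by
    have := inv_lt_one_of_one_lt₀ (by linarith : (1 : ℝ) < n); linarith
  have h1 : 1 + σ * (n : ℝ)⁻¹ ≤ (1 - (n : ℝ)⁻¹) ^ (-σ) := by
    rw [Real.rpow_def_of_pos h0]
    have := Real.add_one_le_exp (Real.log (1 - (n : ℝ)⁻¹) * -σ)
    have h2 := Real.log_le_sub_one_of_pos h0
    nlinarith
  have h2 : ((n : ℝ) - 1) ^ (-σ) = (n : ℝ) ^ (-σ) * (1 - (n : ℝ)⁻¹) ^ (-σ) := by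
    rw [← Real.mul_rpow (by positivity) h0.le]
    congr 1
    field_simp
  have h3 : (n : ℝ) ^ (-1 - σ) = (n : ℝ) ^ (-σ) * (n : ℝ)⁻¹ := by
    rw [show -1 - σ = -σ - 1 by ring, Real.rpow_sub_one (by positivity)]
    rfl
  rw [h2, h3, le_div_iff₀ hσ]
  have := mul_le_mul_of_nonneg_left h1 (by positivity : 0 ≤ (n : ℝ) ^ (-σ))
  linarith

lemma rpow_sub_one_le {n : ℕ} (hn : 1 ≤ n) {τ : ℝ} (hτ : 0 < τ) (hτ1 : τ ≤ 1) :
    (n : ℝ) ^ (τ - 1) ≤ ((n : ℝ) ^ τ - ((n : ℝ) - 1) ^ τ) / τ := by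
  have hn' : (1 : ℝ) ≤ n := by exact_mod_cast hn
  have h0 : 0 ≤ 1 + -(n : ℝ)⁻¹ := by
    have := inv_le_one_of_one_le₀ hn'; linarith
  have h1 : (1 + -(n : ℝ)⁻¹) ^ τ ≤ 1 + τ * -(n : ℝ)⁻¹ :=
    rpow_one_add_le_one_add_mul_self (by linarith) hτ.le hτ1
  have h2 : ((n : ℝ) - 1) ^ τ = (n : ℝ) ^ τ * (1 + -(n : ℝ)⁻¹) ^ τ := by
    rw [← Real.mul_rpow (by positivity) h0]
    congr 1
    field_simp
    ring
  rw [h2, Real.rpow_sub_one (by positivity), le_div_iff₀ hτ]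
  have := mul_le_mul_of_nonneg_left h1 (by positivity : 0 ≤ (n : ℝ) ^ τ)
  rw [div_eq_mul_inv]
  linarith

lemma sum_vonMangoldt_rpow_tail_le {N : ℕ} (hN : 1 ≤ N) (M : ℕ) {σ : ℝ} (hσ : 0 < σ) :
    ∑ n ∈ Finset.Ioc N M, Λ n * (n : ℝ) ^ (-1 - σ)
      ≤ Real.log 4 * ((1 + 1 / σ) * (N : ℝ) ^ (-σ)) := by
  have hl4 : 0 ≤ Real.log 4 := Real.log_nonneg (by norm_num)
  rcases le_or_gt N M with hM | hM
  · have hN' : (1 : ℝ) ≤ N := by exact_mod_cast hN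
    refine (sum_vonMangoldt_mul_le (f := fun n => (n : ℝ) ^ (-1 - σ)) (fun n => by positivity)
      (fun n hn => ?_) hM).trans (mul_le_mul_of_nonneg_left ?_ hl4)
    · have : (0 : ℝ) < n := by exact_mod_cast (by omega : 0 < n)
      exact Real.rpow_le_rpow_of_nonpos this (by push_cast; linarith) (by linarith)
    · have h1 : (N : ℝ) * ((N + 1 : ℕ) : ℝ) ^ (-1 - σ) ≤ (N : ℝ) ^ (-σ) := by
        have : (N : ℝ) ^ (-σ) = N * (N : ℝ) ^ (-1 - σ) := by
          rw [show -1 - σ = -σ - 1 by ring, Real.rpow_sub_one (by positivity)]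
          field_simp
        rw [this]
        refine mul_le_mul_of_nonneg_left ?_ (by positivity)
        exact Real.rpow_le_rpow_of_nonpos (by positivity) (by push_cast; linarith) (by linarith)
      have h2 : ∑ n ∈ Finset.Ioc N M, (n : ℝ) ^ (-1 - σ)
          ≤ ((N : ℝ) ^ (-σ) - (M : ℝ) ^ (-σ)) / σ := by
        induction M, hM using Nat.le_induction with
        | base => simp
        | succ M hM ih =>
          rw [Finset.sum_Ioc_succ_top hM]
          have := rpow_neg_one_sub_le (n := M + 1) (by omega) hσ
          rw [show ((M + 1 : ℕ) : ℝ) - 1 = M by push_cast; ring] at this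
          rw [sub_div] at *
          linarith
      have h3 : 0 ≤ (M : ℝ) ^ (-σ) / σ := by positivity
      rw [sub_div] at h2
      have : (1 + 1 / σ) * (N : ℝ) ^ (-σ) = (N : ℝ) ^ (-σ) + (N : ℝ) ^ (-σ) / σ := by ring
      linarith
  · rw [Finset.Ioc_eq_empty (by omega)]
    simp only [Finset.sum_empty]
    positivity

lemma sum_vonMangoldt_rpow_le (N : ℕ) {τ : ℝ} (hτ : 0 < τ) (hτ1 : τ ≤ 1) :
    ∑ n ∈ Finset.Ioc 0 N, Λ n * (n : ℝ) ^ (τ - 1) ≤ Real.log 4 * ((N : ℝ) ^ τ / τ) := by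
  have hl4 : 0 ≤ Real.log 4 := Real.log_nonneg (by norm_num)
  refine (sum_vonMangoldt_mul_le (f := fun n => (n : ℝ) ^ (τ - 1)) (fun n => by positivity)
    (fun n hn => ?_) (Nat.zero_le N)).trans (mul_le_mul_of_nonneg_left ?_ hl4)
  · have : (0 : ℝ) < n := by exact_mod_cast hn
    exact Real.rpow_le_rpow_of_nonpos this (by push_cast; linarith) (by linarith)
  · rw [Nat.cast_zero, zero_mul, zero_add]
    induction N with
    | zero => simp [Real.zero_rpow hτ.ne']
    | succ N ih =>
      rw [Finset.sum_Ioc_succ_top (Nat.zero_le N)]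
      have := rpow_sub_one_le (n := N + 1) (by omega) hτ hτ1
      rw [show ((N + 1 : ℕ) : ℝ) - 1 = N by push_cast; ring, sub_div] at this
      linarith

end MangoldtPrimePowers

/-! ### Dirichlet `L`-functions in the half plane `0 < Re s` -/

section LBound

open Complex hiding log
open MeasureTheory

variable {m : ℕ} [NeZero m]

lemma sum_range_dirichletCharacter_eq_zero {χ : DirichletCharacter ℂ m} (hχ : χ ≠ 1) :
    ∑ k ∈ Finset.range m, χ (k : ZMod m) = 0 := by
  rw [← MulChar.sum_eq_zero_of_ne_one hχ]
  refine Finset.sum_nbij' (fun k => (k : ZMod m)) ZMod.val ?_ ?_ ?_ ?_ ?_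
  · intro k _; exact Finset.mem_univ _
  · intro a _; exact Finset.mem_range.2 (ZMod.val_lt a)
  · intro k hk; exact ZMod.val_cast_of_lt (Finset.mem_range.1 hk)
  · intro a _; exact ZMod.natCast_zmod_val a
  · intro k _; rfl

lemma norm_sum_range_dirichletCharacter_le {χ : DirichletCharacter ℂ m} (hχ : χ ≠ 1) (n : ℕ) :
    ‖∑ k ∈ Finset.range n, χ (k : ZMod m)‖ ≤ m := by
  induction n using Nat.strong_induction_on with
  | _ n ih =>
    rcases Nat.lt_or_ge n m with h | h
    · calc _ ≤ ∑ k ∈ Finset.range n, ‖χ (k : ZMod m)‖ := norm_sum_le _ _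
        _ ≤ ∑ k ∈ Finset.range n, (1 : ℝ) := Finset.sum_le_sum fun k _ => χ.norm_le_one _
        _ ≤ m := by simpa using h.le
    · obtain ⟨j, rfl⟩ := Nat.exists_eq_add_of_le h
      rw [Finset.sum_range_add, sum_range_dirichletCharacter_eq_zero hχ, zero_add]
      have := ih j (by have := NeZero.pos m; omega)
      simpa using this

lemma norm_sum_Icc_dirichletCharacter_le (hm : m ≠ 1) {χ : DirichletCharacter ℂ m} (hχ : χ ≠ 1)
    (n : ℕ) : ‖∑ k ∈ Finset.Icc 1 n, χ (k : ZMod m)‖ ≤ m := by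
  have h : ∑ k ∈ Finset.range (n + 1), χ (k : ZMod m)
      = ∑ k ∈ Finset.Icc 1 n, χ (k : ZMod m) := by
    rw [Finset.sum_range_succ', Nat.cast_zero, DirichletCharacter.map_zero' χ hm, add_zero,
      Finset.range_eq_Ico, Finset.sum_Ico_add' (fun k : ℕ => χ (k : ZMod m)) 0 n 1]
    refine Finset.sum_congr ?_ fun _ _ => rfl
    ext; simp
  rw [← h]
  exact norm_sum_range_dirichletCharacter_le hχ _

/-- Partial sums of a Dirichlet character, extended by zero to `t ≤ 1`. -/
def charPartialSum (χ : DirichletCharacter ℂ m) : ℝ → ℂ :=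
  Set.indicator (Set.Ioi 1) fun t => ∑ k ∈ Finset.Icc 1 ⌊t⌋₊, χ (k : ZMod m)

lemma norm_charPartialSum_le (hm : m ≠ 1) {χ : DirichletCharacter ℂ m} (hχ : χ ≠ 1) (t : ℝ) :
    ‖charPartialSum χ t‖ ≤ m := by
  unfold charPartialSum
  by_cases h : t ∈ Set.Ioi (1 : ℝ)
  · rw [Set.indicator_of_mem h]
    exact norm_sum_Icc_dirichletCharacter_le hm hχ _
  · rw [Set.indicator_of_notMem h, norm_zero]
    positivity

omit [NeZero m] in
lemma measurable_charPartialSum (χ : DirichletCharacter ℂ m) : Measurable (charPartialSum χ) := by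
  refine Measurable.indicator ?_ measurableSet_Ioi
  exact (measurable_from_nat (f := fun n => ∑ k ∈ Finset.Icc 1 n, χ (k : ZMod m))).comp
    Nat.measurable_floor

lemma differentiableAt_mellin_charPartialSum (hm : m ≠ 1) {χ : DirichletCharacter ℂ m}
    (hχ : χ ≠ 1) {s : ℂ} (hs : s.re < 0) :
    DifferentiableAt ℂ (mellin (charPartialSum χ)) s := by
  refine mellin_differentiableAt_of_isBigO_rpow (a := 0) (b := s.re - 1) ?_ ?_ hs ?_ (by linarith)
  · have : LocallyIntegrable (charPartialSum χ) := by
      refine (MeasureTheory.locallyIntegrable_const (m : ℝ)).mono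
        (measurable_charPartialSum χ).aestronglyMeasurable (Filter.Eventually.of_forall fun t => ?_)
      exact (norm_charPartialSum_le hm hχ t).trans (Real.le_norm_self _)
    exact this.locallyIntegrableOn _
  · refine Asymptotics.IsBigO.of_bound m (Filter.Eventually.of_forall fun t => ?_)
    simpa using norm_charPartialSum_le hm hχ t
  · refine Asymptotics.IsBigO.of_bound 0 ?_
    have : Set.Ioo (0 : ℝ) 1 ∈ nhdsWithin (0 : ℝ) (Set.Ioi 0) := Ioo_mem_nhdsGT one_pos
    filter_upwards [this] with t ht
    rw [charPartialSum, Set.indicator_of_notMem (by simpa using ht.2.le)]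
    simp

omit [NeZero m] in
lemma mellin_charPartialSum (χ : DirichletCharacter ℂ m) (s : ℂ) :
    mellin (charPartialSum χ) (-s) = ∫ t in Set.Ioi (1 : ℝ),
      (∑ k ∈ Finset.Icc 1 ⌊t⌋₊, χ (k : ZMod m)) * (t : ℂ) ^ (-(s + 1)) := by
  unfold mellin charPartialSum
  have : ∀ t : ℝ, (t : ℂ) ^ (-s - 1) • Set.indicator (Set.Ioi (1 : ℝ))
      (fun t => ∑ k ∈ Finset.Icc 1 ⌊t⌋₊, χ (k : ZMod m)) t = Set.indicator (Set.Ioi (1 : ℝ))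
      (fun t : ℝ => (∑ k ∈ Finset.Icc 1 ⌊t⌋₊, χ (k : ZMod m)) * (t : ℂ) ^ (-(s + 1))) t := by
    intro t
    by_cases h : t ∈ Set.Ioi (1 : ℝ)
    · rw [Set.indicator_of_mem h, Set.indicator_of_mem h, smul_eq_mul, mul_comm,
        show -s - 1 = -(s + 1) by ring]
    · rw [Set.indicator_of_notMem h, Set.indicator_of_notMem h, smul_zero]
  simp_rw [this]
  rw [setIntegral_indicator measurableSet_Ioi, Set.inter_eq_right.2
    (Set.Ioi_subset_Ioi zero_le_one)]

lemma LFunction_eq_mellin (hm : m ≠ 1) {χ : DirichletCharacter ℂ m} (hχ : χ ≠ 1) {s : ℂ}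
    (hs : 0 < s.re) : DirichletCharacter.LFunction χ s = s * mellin (charPartialSum χ) (-s) := by
  have hU : IsOpen {s : ℂ | 0 < s.re} := isOpen_lt continuous_const Complex.continuous_re
  have h1 : AnalyticOnNhd ℂ (DirichletCharacter.LFunction χ) {s : ℂ | 0 < s.re} :=
    (DirichletCharacter.differentiable_LFunction hχ).differentiableOn.analyticOnNhd hU
  have h2 : AnalyticOnNhd ℂ (fun s => s * mellin (charPartialSum χ) (-s)) {s : ℂ | 0 < s.re} := by
    refine DifferentiableOn.analyticOnNhd (fun s hs => ?_) hU
    have h3 : DifferentiableAt ℂ (mellin (charPartialSum χ)) (-s) :=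
      differentiableAt_mellin_charPartialSum hm hχ (by simpa using hs)
    exact (differentiableAt_id.mul (h3.comp s differentiable_neg.differentiableAt)).differentiableWithinAt
  refine h1.eqOn_of_preconnected_of_eventuallyEq h2 (convex_halfSpace_re_gt 0).isPreconnected
    (z₀ := 2) (by simp) ?_ hs
  have h4 : {s : ℂ | 1 < s.re} ∈ nhds (2 : ℂ) :=
    (isOpen_lt continuous_const Complex.continuous_re).mem_nhds (by simp)
  filter_upwards [h4] with s hs
  have hs : 1 < s.re := hs
  rw [DirichletCharacter.LFunction_eq_LSeries χ hs, mellin_charPartialSum]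
  refine LSeries_eq_mul_integral _ le_rfl (by linarith)
    (DirichletCharacter.LSeriesSummable_of_one_lt_re χ hs) ?_
  refine Asymptotics.IsBigO.of_bound m (Filter.Eventually.of_forall fun n => ?_)
  simpa using norm_sum_Icc_dirichletCharacter_le hm hχ n

lemma norm_LFunction_le (hm : m ≠ 1) {χ : DirichletCharacter ℂ m} (hχ : χ ≠ 1) {s : ℂ}
    (hs : 0 < s.re) : ‖DirichletCharacter.LFunction χ s‖ ≤ m * (‖s‖ / s.re) := by
  rw [LFunction_eq_mellin hm hχ hs, mellin_charPartialSum, norm_mul]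
  have h_integrable : IntegrableOn (fun t : ℝ => (m : ℝ) * t ^ (-s.re - 1)) (Set.Ioi 1) :=
    (integrableOn_Ioi_rpow_of_lt (by linarith) one_pos).const_mul _
  have h1 : ‖∫ t in Set.Ioi (1 : ℝ), (∑ k ∈ Finset.Icc 1 ⌊t⌋₊, χ (k : ZMod m)) *
      (t : ℂ) ^ (-(s + 1))‖ ≤ ∫ t in Set.Ioi (1 : ℝ), (m : ℝ) * t ^ (-s.re - 1) := by
    refine norm_integral_le_of_norm_le h_integrable ?_
    filter_upwards [self_mem_ae_restrict measurableSet_Ioi] with t ht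
    rw [norm_mul, norm_cpow_eq_rpow_re_of_pos (one_pos.trans ht)]
    have : (-(s + 1)).re = -s.re - 1 := by simp; ring
    rw [this]
    exact mul_le_mul_of_nonneg_right (norm_sum_Icc_dirichletCharacter_le hm hχ _)
      (Real.rpow_nonneg (one_pos.trans ht).le _)
  rw [integral_const_mul, integral_Ioi_rpow_of_lt (by linarith) one_pos] at h1
  have h2 : -(1 : ℝ) ^ (-s.re - 1 + 1) / (-s.re - 1 + 1) = 1 / s.re := by
    rw [Real.one_rpow, show -s.re - 1 + 1 = -s.re by ring, neg_div_neg_eq]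
  rw [h2] at h1
  calc _ ≤ ‖s‖ * (m * (1 / s.re)) := mul_le_mul_of_nonneg_left h1 (norm_nonneg _)
    _ = _ := by ring

end LBound

/-! ### The logarithmic derivative of `L` near `Re s = 1` -/

section LogDeriv

open Complex hiding log

/-- A Borel–Carathéodory bound for the logarithmic derivative of a zero-free function. -/
lemma norm_logDeriv_le_of_norm_le {f : ℂ → ℂ} {c z : ℂ} {A : ℝ} (hA : 0 < A)
    (hf : DifferentiableOn ℂ f (Metric.ball c 1)) (h0 : ∀ x ∈ Metric.ball c 1, f x ≠ 0)
    (hle : ∀ x ∈ Metric.ball c 1, ‖f x‖ ≤ Real.exp A * ‖f c‖) (hz : ‖z - c‖ ≤ 3 / 4) :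
    ‖deriv f z / f z‖ ≤ 57 * A := by
  have hop : IsOpen (Metric.ball c 1) := Metric.isOpen_ball
  have hcb : c ∈ Metric.ball c 1 := Metric.mem_ball_self one_pos
  obtain ⟨h, hc, hh⟩ := ((hf.deriv hop).div hf h0).isExactOn_ball.with_val_at c 0
  have hconst : ∀ x ∈ Metric.ball c 1, f x * Complex.exp (-h x) = f c := by
    intro x hx
    have hd : ∀ y ∈ Metric.ball c 1, HasDerivAt (fun y => f y * Complex.exp (-h y)) 0 y := by
      intro y hy
      have h1 := ((hf.differentiableAt (hop.mem_nhds hy)).hasDerivAt).mul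
        (((hh y hy).neg).cexp)
      refine h1.congr_deriv ?_
      have := h0 y hy
      simp only [Pi.div_apply, Pi.neg_apply]
      field_simp
      ring
    have := hop.is_const_of_deriv_eq_zero (convex_ball c 1).isPreconnected
      (f := fun y => f y * Complex.exp (-h y))
      (fun y hy => (hd y hy).differentiableAt.differentiableWithinAt)
      (fun y hy => (hd y hy).deriv) hx hcb
    simpa [hc] using this
  have hre : ∀ x ∈ Metric.ball c 1, (h x).re ≤ A := by
    intro x hx
    have h1 : ‖f x‖ = Real.exp (h x).re * ‖f c‖ := by
      rw [← hconst x hx, norm_mul, Complex.norm_exp, neg_re, mul_left_comm, ← Real.exp_add]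
      simp
    have h2 := hle x hx
    rw [h1] at h2
    exact Real.exp_le_exp.1 (le_of_mul_le_mul_right h2 (norm_pos_iff.2 (h0 c hcb)))
  have hdiff : DifferentiableOn ℂ h (Metric.ball c 1) := fun y hy =>
    (hh y hy).differentiableAt.differentiableWithinAt
  have hball : ∀ u : ℂ, ‖u‖ < 1 → c + u ∈ Metric.ball c 1 := by
    intro u hu; simpa using hu
  have hball' : ∀ u : ℂ, ‖u‖ < 1 / 4 → z + u ∈ Metric.ball c 1 := by
    intro u hu
    rw [mem_ball_iff_norm]
    calc ‖z + u - c‖ = ‖(z - c) + u‖ := by ring_nf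
      _ ≤ ‖z - c‖ + ‖u‖ := norm_add_le _ _
      _ < 1 := by linarith
  have hzb : z ∈ Metric.ball c 1 := by
    rw [mem_ball_iff_norm]; linarith
  have hhz : ‖h z‖ ≤ 6 * A := by
    have h1 := Complex.borelCaratheodory_zero (f := fun u => h (c + u)) (R := 1) (z := z - c) hA
      (fun u hu => ((hdiff.differentiableAt (hop.mem_nhds (hball u (by simpa using hu)))).comp u
        (by fun_prop)).differentiableWithinAt)
      (fun u hu => hre _ (hball u (by simpa using hu))) one_pos
      (by simpa using hz.trans_lt (by norm_num)) (by simpa using hc)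
    simp only [add_sub_cancel] at h1
    refine h1.trans ?_
    rw [div_le_iff₀ (by linarith)]
    nlinarith [norm_nonneg (z - c)]
  have hinc : ∀ u : ℂ, ‖u‖ < 1 / 4 →
      ‖h (z + u) - h z‖ ≤ 2 * (7 * A) * ‖u‖ / (1 / 4 - ‖u‖) := by
    intro u hu
    refine Complex.borelCaratheodory_zero (f := fun u => h (z + u) - h z) (R := 1 / 4) (z := u)
      (by positivity)
      (fun u hu => (((hdiff.differentiableAt (hop.mem_nhds (hball' u (by simpa using hu)))).comp u
        (by fun_prop)).sub_const _).differentiableWithinAt)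
      (fun u hu => ?_) (by norm_num) (by simpa using hu) (by simp)
    have h1 := hre _ (hball' u (by simpa using hu))
    have h2 := neg_le_of_abs_le (Complex.abs_re_le_norm (h z))
    simp only [Set.mem_ofPred_eq, sub_re]
    linarith
  have hlip := (hh z hzb).hasFDerivAt.le_of_lip' (C := 57 * A) (by positivity) (by
    filter_upwards [Metric.ball_mem_nhds z (ε := 1 / 228) (by norm_num)] with x hx
    rw [mem_ball_iff_norm] at hx
    have h1 := hinc (x - z) (by linarith)
    rw [add_sub_cancel] at h1
    refine h1.trans ?_
    rw [div_le_iff₀ (by linarith)]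
    nlinarith [norm_nonneg (x - z), mul_nonneg hA.le (norm_nonneg (x - z))])
  simpa using hlip

lemma sum_rpow_neg_three_halves_le (N : ℕ) :
    ∑ n ∈ Finset.range N, (if n = 0 then (0 : ℝ) else 1 / (n : ℝ) ^ (3 / 2 : ℝ)) ≤ 3 := by
  have key : ∀ N : ℕ, ∑ n ∈ Finset.range (N + 2),
      (if n = 0 then (0 : ℝ) else 1 / (n : ℝ) ^ (3 / 2 : ℝ)) ≤ 3 - 2 / √((N + 1 : ℕ) : ℝ) := by
    intro N
    induction N with
    | zero => norm_num [Finset.sum_range_succ]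
    | succ N ih =>
      rw [Finset.sum_range_succ, if_neg (by omega)]
      have ha : 0 < √((N + 1 : ℕ) : ℝ) := Real.sqrt_pos.2 (by positivity)
      have hb : 0 < √((N + 1 + 1 : ℕ) : ℝ) := Real.sqrt_pos.2 (by positivity)
      have ha2 : √((N + 1 : ℕ) : ℝ) ^ 2 = N + 1 := by
        rw [Real.sq_sqrt (by positivity)]; push_cast; ring
      have hb2 : √((N + 1 + 1 : ℕ) : ℝ) ^ 2 = N + 2 := by
        rw [Real.sq_sqrt (by positivity)]; push_cast; ring
      have hp : ((N + 2 : ℕ) : ℝ) ^ (3 / 2 : ℝ) = √((N + 1 + 1 : ℕ) : ℝ) ^ 3 := by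
        rw [Real.sqrt_eq_rpow, ← Real.rpow_natCast, ← Real.rpow_mul (by positivity)]
        norm_num [add_assoc]
      rw [hp]
      set a := √((N + 1 : ℕ) : ℝ)
      set b := √((N + 1 + 1 : ℕ) : ℝ)
      have hab : a ≤ b := by nlinarith
      have h1 : 1 / b ^ 3 ≤ 2 / a - 2 / b := by
        rw [div_sub_div _ _ ha.ne' hb.ne', div_le_div_iff₀ (by positivity) (by positivity)]
        have h2 : (b - a) * (b + a) = 1 := by nlinarith
        have h3 : 0 ≤ (2 * b - 2 * a) * b * (b - a) * (2 * b + a) := by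
          have : 0 ≤ b - a := by linarith
          have : 0 ≤ 2 * b - 2 * a := by linarith
          positivity
        have h4 : 0 ≤ (b - a) * b * (2 * b ^ 2 - a * (a + b)) := by
          have h5 : 0 ≤ b - a := by linarith
          have h6 : 0 ≤ 2 * b ^ 2 - a * (a + b) := by nlinarith
          positivity
        have h7 : 1 * (a * b) = (b - a) * (b + a) * (a * b) := by rw [h2]
        rw [h7]
        nlinarith
      linarith
  refine (Finset.sum_le_sum_of_subset_of_nonneg (Finset.range_mono (Nat.le_add_right N 2))
    fun n _ _ => ?_).trans ((key N).trans ?_)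
  · split_ifs <;> positivity
  · have : 0 ≤ 2 / √((N + 1 : ℕ) : ℝ) := by positivity
    linarith

lemma one_le_norm_LFunction_three_halves {m : ℕ} [NeZero m] (χ : DirichletCharacter ℂ m) :
    1 ≤ 3 * ‖DirichletCharacter.LFunction χ (3 / 2)‖ := by
  have hs : 1 < (3 / 2 : ℂ).re := by norm_num
  rw [DirichletCharacter.LFunction_eq_LSeries χ hs]
  have h1 := DirichletCharacter.LSeries.mul_mu_eq_one χ hs
  set g : ℕ → ℂ := (fun n : ℕ => χ n) * (fun n : ℕ => (ArithmeticFunction.moebius n : ℂ)) with hg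
  have hterm : ∀ n, ‖LSeries.term g (3 / 2) n‖
      ≤ if n = 0 then (0 : ℝ) else 1 / (n : ℝ) ^ (3 / 2 : ℝ) := by
    intro n
    rw [LSeries.norm_term_eq]
    have hre : (3 / 2 : ℂ).re = 3 / 2 := by norm_num
    rw [hre]
    split_ifs with h
    · exact le_rfl
    · gcongr
      rw [hg, Pi.mul_apply, norm_mul]
      refine mul_le_one₀ (χ.norm_le_one _) (norm_nonneg _) ?_
      rw [Complex.norm_intCast]
      exact_mod_cast ArithmeticFunction.abs_moebius_le_one
  have hfin : ∀ N, ∑ n ∈ Finset.range N, ‖LSeries.term g (3 / 2) n‖ ≤ 3 := fun N =>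
    (Finset.sum_le_sum fun n _ => hterm n).trans (sum_rpow_neg_three_halves_le N)
  have hsum : Summable fun n => ‖LSeries.term g (3 / 2) n‖ :=
    summable_of_sum_range_le (fun _ => norm_nonneg _) hfin
  have h2 : ‖LSeries g (3 / 2)‖ ≤ 3 :=
    (norm_tsum_le_tsum_norm hsum).trans (hsum.tsum_le_of_sum_range_le hfin)
  have h3 : ‖LSeries (fun n : ℕ => χ n) (3 / 2)‖ * ‖LSeries g (3 / 2)‖ = 1 := by
    rw [← norm_mul, h1, norm_one]
  nlinarith [norm_nonneg (LSeries (fun n : ℕ => χ n) (3 / 2))]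

lemma norm_logDeriv_LFunction_le {m : ℕ} [NeZero m] (hm : 3 ≤ m) (hGRH : GRH m)
    {χ : DirichletCharacter ℂ m} (hχ : χ ≠ 1) {w : ℂ} (hw : ‖w‖ ≤ 1 / 4) :
    ‖deriv (DirichletCharacter.LFunction χ) (1 + w) / DirichletCharacter.LFunction χ (1 + w)‖
      ≤ 57 * Real.log (4.1 * m) := by
  have hm' : (3 : ℝ) ≤ m := by exact_mod_cast hm
  have hball : ∀ x ∈ Metric.ball (3 / 2 : ℂ) 1,
      (x.re - 3 / 2) ^ 2 + x.im ^ 2 < 1 ∧ 1 / 2 < x.re := by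
    intro x hx
    rw [mem_ball_iff_norm] at hx
    have h1 : ‖x - 3 / 2‖ ^ 2 < 1 := by
      have := norm_nonneg (x - 3 / 2); nlinarith
    rw [Complex.sq_norm, Complex.normSq_apply] at h1
    have h2 : (x - 3 / 2).re = x.re - 3 / 2 := by simp
    have h3 : (x - 3 / 2).im = x.im := by simp
    rw [h2, h3] at h1
    refine ⟨by nlinarith, ?_⟩
    nlinarith [sq_nonneg x.im]
  refine norm_logDeriv_le_of_norm_le (c := 3 / 2) (Real.log_pos (by linarith))
    (DirichletCharacter.differentiable_LFunction hχ).differentiableOn ?_ ?_ ?_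
  · intro x hx h0
    obtain ⟨-, h1⟩ := hball x hx
    rcases lt_or_ge x.re 1 with h2 | h2
    · have := hGRH inferInstance χ x h0 (by linarith) h2
      linarith
    · exact DirichletCharacter.LFunction_ne_zero_of_one_le_re χ (Or.inl hχ) h2 h0
  · intro x hx
    obtain ⟨h1, h2⟩ := hball x hx
    rw [Real.exp_log (by linarith)]
    have h3 := norm_LFunction_le (by omega) hχ (s := x) (by linarith)
    have h4 := one_le_norm_LFunction_three_halves χ
    have h5 : ‖x‖ / x.re ≤ 1.342 := by
      rw [div_le_iff₀ (by linarith)]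
      refine abs_le_of_sq_le_sq' ?_ (by linarith) |>.2
      rw [Complex.sq_norm, Complex.normSq_apply]
      nlinarith [sq_nonneg (x.re - 5 / 6)]
    have h6 : ‖DirichletCharacter.LFunction χ x‖ ≤ m * 1.342 :=
      h3.trans (by gcongr)
    have h7 : (m : ℝ) * 1.342 ≤ (m * 1.342) * (3 * ‖DirichletCharacter.LFunction χ (3 / 2)‖) :=
      le_mul_of_one_le_right (by positivity) h4
    have h8 : 0 ≤ (m : ℝ) * ‖DirichletCharacter.LFunction χ (3 / 2)‖ := by positivity
    nlinarith
  · calc ‖1 + w - 3 / 2‖ = ‖w + (-1 / 2 : ℂ)‖ := by ring_nf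
      _ ≤ ‖w‖ + ‖(-1 / 2 : ℂ)‖ := norm_add_le _ _
      _ ≤ 3 / 4 := by
        have : ‖(-1 / 2 : ℂ)‖ = 1 / 2 := by norm_num
        linarith

end LogDeriv

/-! ### Newman's contour argument by the maximum modulus principle -/

section Newman

open Complex hiding log
open ArithmeticFunction hiding log

lemma norm_kernel_eq {w : ℂ} (hw : ‖w‖ = 1 / 4) : ‖1 + 16 * w ^ 2‖ = 8 * |w.re| := by
  have h1 : w.re * w.re + w.im * w.im = 1 / 16 := by
    have := Complex.sq_norm w
    rw [hw, Complex.normSq_apply] at this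
    linarith
  have h2 : (1 : ℂ) + 16 * w ^ 2 = 32 * w * (w.re : ℂ) := by
    apply Complex.ext
    · simp [pow_two]; nlinarith
    · simp [pow_two]; ring
  rw [h2, norm_mul, norm_mul, hw, Complex.norm_real, Real.norm_eq_abs]
  norm_num

lemma mul_rpow_neg_le {N : ℕ} (hN : 2 ≤ N) (τ : ℝ) :
    τ * (N : ℝ) ^ (-τ) ≤ 1 / (Real.exp 1 * Real.log N) := by
  have hN' : (1 : ℝ) < N := by exact_mod_cast (by omega : 1 < N)
  have hlog : 0 < Real.log N := Real.log_pos hN'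
  rw [Real.rpow_def_of_pos (by linarith), le_div_iff₀ (by positivity)]
  have h1 := Real.add_one_le_exp (τ * Real.log N - 1)
  have h2 : Real.exp (Real.log N * -τ) * Real.exp 1 * Real.exp (τ * Real.log N - 1) = 1 := by
    rw [← Real.exp_add, ← Real.exp_add]; ring_nf; simp
  have h3 : 0 < Real.exp (Real.log N * -τ) * Real.exp 1 := by positivity
  calc τ * Real.exp (Real.log N * -τ) * (Real.exp 1 * Real.log N)
      = Real.exp (Real.log N * -τ) * Real.exp 1 * (τ * Real.log N) := by ring
    _ ≤ Real.exp (Real.log N * -τ) * Real.exp 1 * Real.exp (τ * Real.log N - 1) := by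
        gcongr; linarith
    _ = 1 := h2

variable {a : ℕ → ℂ}

/-- The partial sums of the Dirichlet series of `a`, centred at `1`. -/
def dirichletPartial (a : ℕ → ℂ) (N : ℕ) (w : ℂ) : ℂ :=
  ∑ n ∈ Finset.Ioc 0 N, a n * (n : ℂ) ^ (-(1 + w))

lemma norm_dirichletPartial_term_le (ha : ∀ n, ‖a n‖ ≤ Λ n) {n : ℕ} (hn : 0 < n) (w : ℂ) :
    ‖a n * (n : ℂ) ^ (-(1 + w))‖ ≤ Λ n * (n : ℝ) ^ (-1 - w.re) := by
  rw [norm_mul, norm_natCast_cpow_of_pos hn]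
  have : (-(1 + w)).re = -1 - w.re := by simp; ring
  rw [this]
  exact mul_le_mul_of_nonneg_right (ha n) (by positivity)

lemma norm_LSeries_sub_dirichletPartial_le (ha : ∀ n, ‖a n‖ ≤ Λ n) {N : ℕ} (hN : 1 ≤ N) {w : ℂ}
    (hw : 0 < w.re) : ‖LSeries a (1 + w) - dirichletPartial a N w‖
      ≤ Real.log 4 * ((1 + 1 / w.re) * (N : ℝ) ^ (-w.re)) := by
  have hsum : LSeriesSummable a (1 + w) := by
    have h1 : LSeriesSummable (fun n => (Λ n : ℂ)) (1 + w) :=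
      LSeriesSummable_vonMangoldt (by simpa using hw)
    rw [LSeriesSummable, ← summable_norm_iff] at h1 ⊢
    refine h1.of_nonneg_of_le (fun _ => norm_nonneg _) fun n => LSeries.norm_term_le _ ?_
    simpa [abs_of_nonneg (vonMangoldt_nonneg (n := n))] using ha n
  have ht := (hsum.hasSum.tendsto_sum_nat.sub_const (dirichletPartial a N w)).norm
  refine le_of_tendsto ht ?_
  filter_upwards [Filter.eventually_ge_atTop (N + 1)] with M hM
  obtain ⟨M, rfl⟩ : ∃ M', M = M' + 1 := ⟨M - 1, by omega⟩
  have h2 : ∑ n ∈ Finset.range (M + 1), LSeries.term a (1 + w) n = dirichletPartial a M w := by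
    unfold dirichletPartial
    rw [Finset.sum_range_succ', LSeries.term_zero, add_zero, Finset.range_eq_Ico,
      Finset.sum_Ico_add' (fun k : ℕ => LSeries.term a (1 + w) k) 0 M 1]
    refine Finset.sum_congr (by ext; simp; omega) fun n hn => ?_
    rw [LSeries.term_of_ne_zero (by simp at hn; omega), Complex.cpow_neg, div_eq_mul_inv]
  have h3 : dirichletPartial a M w - dirichletPartial a N w
      = ∑ n ∈ Finset.Ioc N M, a n * (n : ℂ) ^ (-(1 + w)) := by
    unfold dirichletPartial
    rw [← Finset.sum_Ioc_consecutive _ (Nat.zero_le N) (by omega : N ≤ M), add_sub_cancel_left]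
  rw [h2, h3]
  refine (norm_sum_le _ _).trans ((Finset.sum_le_sum fun n hn => ?_).trans
    (sum_vonMangoldt_rpow_tail_le hN M hw))
  exact norm_dirichletPartial_term_le ha (by simp at hn; omega) w

lemma norm_dirichletPartial_le (ha : ∀ n, ‖a n‖ ≤ Λ n) (N : ℕ) {w : ℂ} (hw : w.re < 0)
    (hw1 : -w.re ≤ 1) :
    ‖dirichletPartial a N w‖ ≤ Real.log 4 * ((N : ℝ) ^ (-w.re) / (-w.re)) := by
  refine (norm_sum_le _ _).trans ((Finset.sum_le_sum fun n hn => ?_).trans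
    (sum_vonMangoldt_rpow_le N (neg_pos.2 hw) hw1))
  refine (norm_dirichletPartial_term_le ha (by simp at hn; omega) w).trans (le_of_eq ?_)
  ring_nf

lemma norm_sub_dirichletPartial_le (ha : ∀ n, ‖a n‖ ≤ Λ n) {F : ℂ → ℂ} {K : ℝ}
    (hF : ∀ w, ‖w‖ ≤ 1 / 4 → DifferentiableAt ℂ F w) (hK : ∀ w, ‖w‖ ≤ 1 / 4 → ‖F w‖ ≤ K)
    (hL : ∀ w, ‖w‖ ≤ 1 / 4 → 0 < w.re → F w = LSeries a (1 + w)) {N : ℕ} (hN : 2 ≤ N) :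
    ‖F 0 - dirichletPartial a N 0‖
      ≤ max (10 * Real.log 4) (8 * Real.log 4 + 8 * K / (Real.exp 1 * Real.log N)) := by
  have hN0 : (0 : ℝ) < N := by positivity
  have hNC : (N : ℂ) ≠ 0 := by exact_mod_cast hN0.ne'
  have hl4 : 0 < Real.log 4 := Real.log_pos (by norm_num)
  have hK0 : 0 ≤ K := (norm_nonneg _).trans (hK 0 (by simp))
  set g : ℂ → ℂ := fun w => (F w - dirichletPartial a N w) * (N : ℂ) ^ w * (1 + 16 * w ^ 2) with hg
  have hg0 : g 0 = F 0 - dirichletPartial a N 0 := by simp [hg]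
  have hS : Differentiable ℂ (dirichletPartial a N) := by
    unfold dirichletPartial
    refine Differentiable.fun_sum fun n hn => ?_
    have hn0 : (n : ℂ) ≠ 0 := by
      simp at hn
      exact_mod_cast (by omega : n ≠ 0)
    refine Differentiable.const_mul (Differentiable.const_cpow (by fun_prop) (Or.inl hn0)) _
  have hd : DiffContOnCl ℂ g (Metric.ball 0 (1 / 4)) := by
    refine DifferentiableOn.diffContOnCl_ball (U := Metric.closedBall 0 (1 / 4))
      (fun w hw => ?_) subset_rfl
    have hw' : ‖w‖ ≤ 1 / 4 := by simpa using hw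
    have h1 : DifferentiableAt ℂ (fun w : ℂ => (N : ℂ) ^ w) w :=
      differentiableAt_id.const_cpow (Or.inl hNC)
    have h2 : DifferentiableAt ℂ (fun w : ℂ => 1 + 16 * w ^ 2) w := by fun_prop
    exact ((((hF w hw').sub (hS w)).mul h1).mul h2).differentiableWithinAt
  rw [← hg0]
  refine Complex.norm_le_of_forall_mem_frontier_norm_le Metric.isBounded_ball hd (fun w hw => ?_)
    (subset_closure (Metric.mem_ball_self (by norm_num)))
  rw [frontier_ball _ (by norm_num)] at hw
  have hw' : ‖w‖ = 1 / 4 := by simpa using hw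
  have hre : |w.re| ≤ 1 / 4 := hw' ▸ Complex.abs_re_le_norm w
  have hgn : ‖g w‖ = ‖F w - dirichletPartial a N w‖ * (N : ℝ) ^ w.re * (8 * |w.re|) := by
    rw [hg, norm_mul, norm_mul, norm_natCast_cpow_of_pos (by omega), norm_kernel_eq hw']
  rw [hgn]
  have hpp : (N : ℝ) ^ (-w.re) * (N : ℝ) ^ w.re = 1 := by
    rw [← Real.rpow_add hN0]; simp
  rcases lt_trichotomy w.re 0 with h | h | h
  · refine le_max_of_le_right ?_
    rw [abs_of_neg h] at hre ⊢
    have h1 : ‖F w - dirichletPartial a N w‖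
        ≤ K + Real.log 4 * ((N : ℝ) ^ (-w.re) / (-w.re)) :=
      (norm_sub_le _ _).trans (add_le_add (hK w hw'.le)
        (norm_dirichletPartial_le ha N h (by linarith)))
    have h2 := mul_rpow_neg_le hN (-w.re)
    rw [neg_neg] at h2
    have hpos : 0 < -w.re := by linarith
    calc _ ≤ (K + Real.log 4 * ((N : ℝ) ^ (-w.re) / (-w.re))) * (N : ℝ) ^ w.re * (8 * -w.re) := by
          gcongr
      _ = 8 * K * (-w.re * (N : ℝ) ^ w.re)
          + 8 * Real.log 4 * ((N : ℝ) ^ (-w.re) * (N : ℝ) ^ w.re) := by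
          have hne : w.re ≠ 0 := h.ne
          generalize (N : ℝ) ^ (-w.re) = u
          generalize (N : ℝ) ^ w.re = v
          field_simp
          ring
      _ ≤ 8 * K * (1 / (Real.exp 1 * Real.log N)) + 8 * Real.log 4 * 1 := by
          rw [hpp]; gcongr
      _ = _ := by ring
  · rw [h]; simp [hl4.le]
  · refine le_max_of_le_left ?_
    rw [abs_of_pos h] at hre ⊢
    rw [hL w hw'.le h]
    have h1 := norm_LSeries_sub_dirichletPartial_le ha (by omega : 1 ≤ N) h
    calc _ ≤ Real.log 4 * ((1 + 1 / w.re) * (N : ℝ) ^ (-w.re)) * (N : ℝ) ^ w.re * (8 * w.re) := by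
          gcongr
      _ = 8 * Real.log 4 * (1 + w.re) * ((N : ℝ) ^ (-w.re) * (N : ℝ) ^ w.re) := by
          field_simp
          ring
      _ ≤ 10 * Real.log 4 := by
          rw [hpp]; nlinarith

end Newman

/-! ### Weighted prime sums in unions of residue classes -/

section ResidueClasses

open Complex hiding log
open ArithmeticFunction hiding log

/-- The indicator function of a set `A` of residues modulo `m`, minus its mean over the reduced
residues. -/
def residueWeight (m : ℕ) (A : Finset ℕ) (n : ℕ) : ℝ :=
  (if n % m ∈ A then 1 else 0) - (A.card / m.totient : ℝ) * (if n.Coprime m then 1 else 0)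

variable {m : ℕ} {A : Finset ℕ}

lemma card_le_totient_of_coprime (hA : ∀ a ∈ A, a < m ∧ Nat.Coprime a m) :
    A.card ≤ m.totient := by
  rw [Nat.totient_eq_card_coprime]
  refine Finset.card_le_card fun a ha => ?_
  simpa [(hA a ha).1] using (hA a ha).2.symm

lemma abs_residueWeight_le_one [NeZero m] (hA : ∀ a ∈ A, a < m ∧ Nat.Coprime a m) (n : ℕ) :
    |residueWeight m A n| ≤ 1 := by
  have hφ : (0 : ℝ) < m.totient := by exact_mod_cast Nat.totient_pos.2 (NeZero.pos m)
  have h1 : (A.card / m.totient : ℝ) ≤ 1 := by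
    rw [div_le_one hφ]; exact_mod_cast card_le_totient_of_coprime hA
  have h0 : 0 ≤ (A.card / m.totient : ℝ) := by positivity
  unfold residueWeight
  rw [abs_le]
  by_cases h : n % m ∈ A
  · have : n.Coprime m := by
      have h2 := (hA _ h).2
      rwa [← ZMod.isUnit_iff_coprime, ZMod.natCast_mod, ZMod.isUnit_iff_coprime] at h2
    rw [if_pos h, if_pos this]
    constructor <;> linarith
  · rw [if_neg h]
    split_ifs <;> constructor <;> linarith

/-- The coefficient of the nontrivial character `χ` in the expansion of `residueWeight`. -/
def charCoeff (A : Finset ℕ) (χ : DirichletCharacter ℂ m) : ℂ :=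
  (m.totient : ℂ)⁻¹ * ∑ b ∈ A, χ ((b : ZMod m)⁻¹)

lemma norm_charCoeff_le [NeZero m] (hA : ∀ a ∈ A, a < m ∧ Nat.Coprime a m)
    (χ : DirichletCharacter ℂ m) : ‖charCoeff A χ‖ ≤ 1 := by
  have hφ : (0 : ℝ) < m.totient := by exact_mod_cast Nat.totient_pos.2 (NeZero.pos m)
  have h1 : ‖∑ b ∈ A, χ ((b : ZMod m)⁻¹)‖ ≤ m.totient :=
    calc _ ≤ ∑ b ∈ A, ‖χ ((b : ZMod m)⁻¹)‖ := norm_sum_le _ _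
      _ ≤ ∑ b ∈ A, (1 : ℝ) := Finset.sum_le_sum fun _ _ => χ.norm_le_one _
      _ ≤ m.totient := by simpa using card_le_totient_of_coprime hA
  rw [charCoeff, norm_mul, norm_inv, Complex.norm_natCast, inv_mul_le_iff₀ hφ, mul_one]
  exact h1

lemma sum_charCoeff_mul_eq [NeZero m] (hA : ∀ a ∈ A, a < m ∧ Nat.Coprime a m) (n : ℕ) :
    ∑ χ ∈ Finset.univ.erase (1 : DirichletCharacter ℂ m), charCoeff A χ * χ n
      = (residueWeight m A n : ℂ) := by
  have hφ : (m.totient : ℂ) ≠ 0 := by exact_mod_cast (Nat.totient_pos.2 (NeZero.pos m)).ne'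
  have hall : ∑ χ : DirichletCharacter ℂ m, charCoeff A χ * χ n
      = if n % m ∈ A then 1 else 0 := by
    have h1 : ∀ χ : DirichletCharacter ℂ m, charCoeff A χ * χ n
        = (m.totient : ℂ)⁻¹ * ∑ b ∈ A, χ ((b : ZMod m)⁻¹) * χ n := fun χ => by
      rw [charCoeff, mul_assoc, Finset.sum_mul]
    simp_rw [h1]
    rw [← Finset.mul_sum, Finset.sum_comm]
    have h2 : ∀ b ∈ A, ∑ χ : DirichletCharacter ℂ m, χ ((b : ZMod m)⁻¹) * χ n
        = if n % m = b then (m.totient : ℂ) else 0 := by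
      intro b hb
      rw [DirichletCharacter.sum_char_inv_mul_char_eq ℂ ((ZMod.isUnit_iff_coprime b m).2 (hA b hb).2)]
      refine if_congr ?_ rfl rfl
      rw [ZMod.natCast_eq_natCast_iff', Nat.mod_eq_of_lt (hA b hb).1, eq_comm]
    rw [Finset.sum_congr rfl h2, Finset.sum_ite_eq, mul_ite, inv_mul_cancel₀ hφ, mul_zero]
  have hone : charCoeff A (1 : DirichletCharacter ℂ m) * (1 : DirichletCharacter ℂ m) n
      = (A.card / m.totient : ℂ) * (if n.Coprime m then 1 else 0) := by
    have h1 : ∑ b ∈ A, (1 : DirichletCharacter ℂ m) ((b : ZMod m)⁻¹) = A.card := by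
      rw [Finset.sum_congr rfl (g := fun _ => (1 : ℂ)), Finset.sum_const, nsmul_one]
      intro b hb
      have hu : IsUnit ((b : ZMod m)⁻¹) := by
        obtain ⟨u, hu⟩ := (ZMod.isUnit_iff_coprime b m).2 (hA b hb).2
        rw [← hu, ZMod.inv_coe_unit]
        exact u⁻¹.isUnit
      exact MulChar.one_apply hu
    rw [charCoeff, h1, inv_mul_eq_div]
    congr 1
    split_ifs with h
    · exact MulChar.one_apply ((ZMod.isUnit_iff_coprime n m).2 h)
    · exact MulChar.map_nonunit _ fun h' => h ((ZMod.isUnit_iff_coprime n m).1 h')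
  rw [← Finset.add_sum_erase _ _ (Finset.mem_univ (1 : DirichletCharacter ℂ m)), hone] at hall
  rw [← sub_eq_iff_eq_add'.2 hall.symm, residueWeight]
  split_ifs <;> push_cast <;> rfl

lemma totient_sub_one_mul_log_le (hm : 3 ≤ m) {Q : ℝ} (hQ : m.totient * Real.log m ≤ Q) :
    ((m.totient : ℝ) - 1) * Real.log (4.1 * m) ≤ 1.6 * Q := by
  have hm0 : (0 : ℝ) < m := by positivity
  have hl2 := Real.log_two_gt_d9
  have hl2' := Real.log_two_lt_d9
  have hφ1 : (1 : ℝ) ≤ m.totient := by exact_mod_cast Nat.totient_pos.2 (by omega)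
  have hφm : m.totient < m := Nat.totient_lt m (by omega)
  have h41 : Real.log 4.1 ≤ 1.4114 := by
    have h1 : Real.log 4.1 = 2 * Real.log 2 + Real.log 1.025 := by
      rw [← Real.log_rpow (by norm_num), ← Real.log_mul (by norm_num) (by norm_num)]
      norm_num
    have h2 := Real.log_le_sub_one_of_pos (show (0 : ℝ) < 1.025 by norm_num)
    linarith
  rw [Real.log_mul (by norm_num) (by positivity)]
  have hpow : ∀ a b : ℕ, 2 ^ b ≤ m ^ a → b * Real.log 2 ≤ a * Real.log m := by
    intro a b h
    rw [← Real.log_pow, ← Real.log_pow]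
    exact Real.log_le_log (by positivity) (by exact_mod_cast h)
  suffices h : ((m.totient : ℝ) - 1) * 1.4114 ≤ (0.6 * m.totient + 1) * Real.log m by
    nlinarith
  rcases Nat.lt_or_ge m.totient 4 with h | h
  · have h1 := hpow 2 3 ((by norm_num : 2 ^ 3 ≤ 3 ^ 2).trans (Nat.pow_le_pow_left hm 2))
    have : (m.totient : ℝ) ≤ 3 := by exact_mod_cast (by omega : m.totient ≤ 3)
    push_cast at h1
    nlinarith
  rcases Nat.lt_or_ge m.totient 5 with h | h
  · have h1 := hpow 1 2 (by rw [pow_one]; omega)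
    have : (m.totient : ℝ) ≤ 4 := by exact_mod_cast (by omega : m.totient ≤ 4)
    push_cast at h1
    nlinarith
  rcases Nat.lt_or_ge m.totient 9 with h | h
  · have h1 := hpow 2 5 ((by norm_num : 2 ^ 5 ≤ 6 ^ 2).trans
      (Nat.pow_le_pow_left (by omega : 6 ≤ m) 2))
    have : (m.totient : ℝ) ≤ 8 := by exact_mod_cast (by omega : m.totient ≤ 8)
    push_cast at h1
    nlinarith
  rcases Nat.lt_or_ge m.totient 22 with h | h
  · have h1 := hpow 1 3 (by rw [pow_one]; omega)
    have : (m.totient : ℝ) ≤ 21 := by exact_mod_cast (by omega : m.totient ≤ 21)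
    push_cast at h1
    nlinarith
  · have h1 := hpow 1 4 (by rw [pow_one]; omega)
    push_cast at h1
    nlinarith

lemma LFunction_one_add_ne_zero [NeZero m] (hGRH : GRH m) {χ : DirichletCharacter ℂ m}
    (hχ : χ ≠ 1) {w : ℂ} (hw : ‖w‖ ≤ 1 / 4) : DirichletCharacter.LFunction χ (1 + w) ≠ 0 := by
  intro h0
  have h1 := neg_le_of_abs_le (Complex.abs_re_le_norm w)
  have h2 : (1 + w).re = 1 + w.re := by simp
  rcases lt_or_ge (1 + w).re 1 with h | h
  · have := hGRH inferInstance χ _ h0 (by linarith) h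
    linarith
  · exact DirichletCharacter.LFunction_ne_zero_of_one_le_re χ (Or.inl hχ) h h0

/-- The analytic continuation of the Dirichlet series with coefficients
`residueWeight m A n * Λ n`, centred at `1`. -/
def residueSeries [NeZero m] (A : Finset ℕ) (w : ℂ) : ℂ :=
  ∑ χ ∈ Finset.univ.erase (1 : DirichletCharacter ℂ m), charCoeff A χ *
    (-deriv (DirichletCharacter.LFunction χ) (1 + w) / DirichletCharacter.LFunction χ (1 + w))

lemma residueSeries_eq_LSeries [NeZero m] (hA : ∀ a ∈ A, a < m ∧ Nat.Coprime a m) {w : ℂ}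
    (hw : 0 < w.re) : residueSeries (m := m) A w
      = LSeries (fun n => ((residueWeight m A n * Λ n : ℝ) : ℂ)) (1 + w) := by
  have hs : 1 < (1 + w).re := by simpa using hw
  unfold residueSeries
  simp only [DirichletCharacter.deriv_LFunction_eq_deriv_LSeries _ hs,
    DirichletCharacter.LFunction_eq_LSeries _ hs,
    ← DirichletCharacter.LSeries_twist_vonMangoldt_eq _ hs]
  simp_rw [← LSeries_smul]
  rw [← LSeries_sum fun χ _ =>
    (DirichletCharacter.LSeriesSummable_twist_vonMangoldt χ hs).smul _]
  refine LSeries_congr (fun {n} _ => ?_) _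
  push_cast
  rw [← sum_charCoeff_mul_eq hA, Finset.sum_mul]
  simp [Finset.sum_apply, mul_assoc]

lemma card_erase_one_dirichletCharacter [NeZero m] :
    ((Finset.univ.erase (1 : DirichletCharacter ℂ m)).card : ℝ) = m.totient - 1 := by
  rw [Finset.card_erase_of_mem (Finset.mem_univ _), Finset.card_univ, ← Nat.card_eq_fintype_card,
    DirichletCharacter.card_eq_totient_of_hasEnoughRootsOfUnity,
    Nat.cast_sub (Nat.totient_pos.2 (NeZero.pos m)), Nat.cast_one]

lemma norm_residueSeries_sub_le [NeZero m] (hm : 3 ≤ m) (hGRH : GRH m)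
    (hA : ∀ a ∈ A, a < m ∧ Nat.Coprime a m) {Q : ℝ} (hQ : m.totient * Real.log m ≤ Q)
    {N : ℕ} (hN : 2 ≤ N) :
    ‖residueSeries (m := m) A 0
        - ((∑ n ∈ Finset.Ioc 0 N, residueWeight m A n * Λ n / n : ℝ) : ℂ)‖
      ≤ max (10 * Real.log 4) (8 * Real.log 4 + 8 * (91.2 * Q) / (Real.exp 1 * Real.log N)) := by
  have h := norm_sub_dirichletPartial_le
    (a := fun n => ((residueWeight m A n * Λ n : ℝ) : ℂ)) (F := residueSeries (m := m) A)
    (K := 91.2 * Q) ?_ ?_ ?_ (fun w _ hw => residueSeries_eq_LSeries hA hw) hN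
  · convert h using 3
    unfold dirichletPartial
    push_cast
    refine Finset.sum_congr rfl fun n _ => ?_
    rw [add_zero, Complex.cpow_neg_one, div_eq_mul_inv]
  · intro n
    rw [Complex.norm_real, Real.norm_eq_abs, abs_mul, abs_of_nonneg vonMangoldt_nonneg]
    exact mul_le_of_le_one_left vonMangoldt_nonneg (abs_residueWeight_le_one hA n)
  · intro w hw
    unfold residueSeries
    refine DifferentiableAt.fun_sum fun χ hχ => ?_
    have hχ : χ ≠ 1 := Finset.ne_of_mem_erase hχ
    have hd := DirichletCharacter.differentiable_LFunction hχ
    have hd' : Differentiable ℂ (deriv (DirichletCharacter.LFunction χ)) :=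
      differentiableOn_univ.1 (hd.differentiableOn.deriv isOpen_univ)
    have h1 : DifferentiableAt ℂ (fun w => DirichletCharacter.LFunction χ (1 + w)) w :=
      (hd _).comp w (by fun_prop)
    have h2 : DifferentiableAt ℂ (fun w => deriv (DirichletCharacter.LFunction χ) (1 + w)) w :=
      (hd' _).comp w (by fun_prop)
    exact (h2.neg.div h1 (LFunction_one_add_ne_zero hGRH hχ hw)).const_mul _
  · intro w hw
    unfold residueSeries
    calc _ ≤ ∑ χ ∈ Finset.univ.erase (1 : DirichletCharacter ℂ m), 57 * Real.log (4.1 * m) := by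
          refine (norm_sum_le _ _).trans (Finset.sum_le_sum fun χ hχ => ?_)
          rw [norm_mul, neg_div, norm_neg]
          exact (mul_le_of_le_one_left (norm_nonneg _) (norm_charCoeff_le hA χ)).trans
            (norm_logDeriv_LFunction_le hm hGRH (Finset.ne_of_mem_erase hχ) hw)
      _ = 57 * ((m.totient - 1) * Real.log (4.1 * m)) := by
          rw [Finset.sum_const, nsmul_eq_mul, card_erase_one_dirichletCharacter]; ring
      _ ≤ 57 * (1.6 * Q) := mul_le_mul_of_nonneg_left (totient_sub_one_mul_log_le hm hQ) (by norm_num)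
      _ = 91.2 * Q := by ring

lemma abs_sum_residueWeight_le (hm : 3 ≤ m) (hGRH : GRH m)
    (hA : ∀ a ∈ A, a < m ∧ Nat.Coprime a m) {Q : ℝ} (hQ0 : 0 < Q)
    (hQ : m.totient * Real.log m ≤ Q) {Y N : ℕ} (hYN : Y ≤ N)
    (hY : 6 * Q ≤ Real.log Y) (hN : 120 * Q ≤ Real.log N) :
    |∑ n ∈ Finset.Ioc Y N, residueWeight m A n * Λ n / n| ≤ 69.7 := by
  have : NeZero m := ⟨by omega⟩
  have hl2 := Real.log_two_gt_d9
  have hl2' := Real.log_two_lt_d9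
  have he := Real.exp_one_gt_d9
  have hl4 : Real.log 4 = 2 * Real.log 2 := by
    rw [← Real.log_rpow (by norm_num)]; norm_num
  have hY2 : 2 ≤ Y := by
    by_contra h
    have : Y = 0 ∨ Y = 1 := by omega
    rcases this with rfl | rfl <;> simp at hY <;> linarith
  have h1 := norm_residueSeries_sub_le hm hGRH hA hQ hY2
  have h2 := norm_residueSeries_sub_le hm hGRH hA hQ (hY2.trans hYN)
  have hbd : ∀ t c : ℝ, 0 < c → c * Q ≤ t →
      8 * (91.2 * Q) / (Real.exp 1 * t) ≤ 268.41 / c := by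
    intro t c hc ht
    have : 0 < t := (mul_pos hc hQ0).trans_le ht
    rw [div_le_div_iff₀ (by positivity) hc]
    nlinarith [mul_le_mul_of_nonneg_left ht (Real.exp_pos 1).le]
  have hY' := hbd _ 6 (by norm_num) hY
  have hN' := hbd _ 120 (by norm_num) hN
  have h1' : max (10 * Real.log 4) (8 * Real.log 4 + 8 * (91.2 * Q) / (Real.exp 1 * Real.log Y))
      ≤ 55.83 := max_le (by linarith) (by linarith)
  have h2' : max (10 * Real.log 4) (8 * Real.log 4 + 8 * (91.2 * Q) / (Real.exp 1 * Real.log N))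
      ≤ 13.87 := max_le (by linarith) (by linarith)
  have hsum := Finset.sum_Ioc_consecutive (fun n : ℕ => residueWeight m A n * Λ n / n)
    (Nat.zero_le Y) hYN
  rw [← Real.norm_eq_abs, ← Complex.norm_real, ← sub_eq_iff_eq_add'.2 hsum.symm]
  set u := ∑ n ∈ Finset.Ioc 0 Y, residueWeight m A n * Λ n / n
  set v := ∑ n ∈ Finset.Ioc 0 N, residueWeight m A n * Λ n / n
  have h3 : ((v - u : ℝ) : ℂ) = (residueSeries (m := m) A 0 - u) - (residueSeries (m := m) A 0 - v) := by
    push_cast; ring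
  rw [h3]
  refine (norm_sub_le _ _).trans ?_
  linarith

end ResidueClasses

section PrimeSums

open ArithmeticFunction hiding log

variable {m : ℕ} {A : Finset ℕ}

lemma le_sum_prime_log_mul_div (hm : 3 ≤ m) (hGRH : GRH m)
    (hA : ∀ a ∈ A, a < m ∧ Nat.Coprime a m) {Q : ℝ} (hQ0 : 0 < Q)
    (hQ : m.totient * Real.log m ≤ Q) {Y N : ℕ} (hYN : Y ≤ N)
    (hY : 6 * Q ≤ Real.log Y) (hN : 120 * Q ≤ Real.log N) :
    N * ((A.card / m.totient : ℝ) * (Real.log N - Real.log Y) - 78)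
      ≤ ∑ p ∈ Finset.Ioc Y N with (p.Prime ∧ p % m ∈ A), Real.log p * ((N / p : ℕ) : ℝ) := by
  have hl2' := Real.log_two_lt_d9
  have hl4 : Real.log 4 = 2 * Real.log 2 := by
    rw [← Real.log_rpow (by norm_num)]; norm_num
  have hφ1 : (1 : ℝ) ≤ m.totient := by exact_mod_cast Nat.totient_pos.2 (by omega)
  have hlogm : 0 ≤ Real.log m := Real.log_natCast_nonneg m
  have hY0 : 0 < Y := by
    rcases Nat.eq_zero_or_pos Y with h | h
    · rw [h] at hY; simp at hY; linarith
    · exact h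
  have hmY : m ≤ Y := by
    have h1 : Real.log m ≤ Real.log Y := by nlinarith
    exact_mod_cast (Real.log_le_log_iff (by positivity) (by positivity)).1 h1
  set r : ℝ := A.card / m.totient with hr
  have hr0 : 0 ≤ r := by positivity
  have hr1 : r ≤ 1 := by
    rw [hr, div_le_one (by linarith)]; exact_mod_cast card_le_totient_of_coprime hA
  have hpt : ∀ n ∈ Finset.Ioc Y N, residueWeight m A n * Λ n / n + r * (Λ n / n)
      - 2 * (if n.Prime then 0 else Λ n / n)
      ≤ if n.Prime ∧ n % m ∈ A then Λ n / n else 0 := by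
    intro n hn
    rw [Finset.mem_Ioc] at hn
    have h0 : 0 ≤ Λ n / n := div_nonneg vonMangoldt_nonneg (Nat.cast_nonneg n)
    unfold residueWeight
    rw [← hr, mul_div_assoc]
    by_cases hp : n.Prime
    · have hc : n.Coprime m := (Nat.Prime.coprime_iff_not_dvd hp).2 fun h =>
        absurd (Nat.le_of_dvd (by omega) h) (by omega)
      simp only [hp, true_and, if_true]
      split_ifs <;> linarith
    · simp only [hp, false_and, if_false]
      have h1 : r * (Λ n / n) ≤ Λ n / n := mul_le_of_le_one_left h0 hr1
      have h2 : 0 ≤ r * (Λ n / n) := mul_nonneg hr0 h0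
      split_ifs <;> linarith
  have hsum := Finset.sum_le_sum hpt
  rw [Finset.sum_sub_distrib, Finset.sum_add_distrib, ← Finset.mul_sum, ← Finset.mul_sum,
    ← Finset.sum_filter] at hsum
  have hw := (abs_le.1 (abs_sum_residueWeight_le hm hGRH hA hQ0 hQ hYN hY hN)).1
  have hnp : ∑ n ∈ Finset.Ioc Y N, (if n.Prime then 0 else Λ n / n) ≤ 2 := by
    refine le_trans ?_ (sum_vonMangoldt_not_prime_le N)
    rw [Finset.sum_filter]
    refine (Finset.sum_le_sum_of_subset_of_nonneg (Finset.Ioc_subset_Ioc_left (Nat.zero_le Y))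
      fun n _ _ => ?_).trans (le_of_eq ?_)
    · split_ifs
      · exact le_rfl
      · exact div_nonneg vonMangoldt_nonneg (Nat.cast_nonneg n)
    · refine Finset.sum_congr rfl fun n _ => ?_
      by_cases hp : n.Prime <;> simp [hp]
  have hmert : Real.log N - 1 - (Real.log Y + Real.log 4) ≤ ∑ n ∈ Finset.Ioc Y N, Λ n / n := by
    have h1 := log_le_sum_vonMangoldt_div (hY0.trans_le hYN)
    have h2 := sum_vonMangoldt_div_le hY0
    have h3 := Finset.sum_Ioc_consecutive (fun n : ℕ => Λ n / n) (Nat.zero_le Y) hYN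
    linarith
  have hmain : r * (Real.log N - Real.log Y) - 76.2
      ≤ ∑ p ∈ Finset.Ioc Y N with (p.Prime ∧ p % m ∈ A), Λ p / p := by
    have h1 := mul_le_mul_of_nonneg_left hmert hr0
    have h2 : r * (1 + Real.log 4) ≤ 1 * (1 + Real.log 4) :=
      mul_le_mul_of_nonneg_right hr1 (by linarith [Real.log_nonneg (show (1 : ℝ) ≤ 4 by norm_num)])
    nlinarith
  have hpsi : ∑ p ∈ Finset.Ioc Y N with (p.Prime ∧ p % m ∈ A), Λ p ≤ Real.log 4 * N := by
    refine le_trans (Finset.sum_le_sum_of_subset_of_nonneg ?_ fun _ _ _ => vonMangoldt_nonneg)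
      (psiNat_le N)
    exact (Finset.filter_subset _ _).trans (Finset.Ioc_subset_Ioc_left (Nat.zero_le Y))
  have hfloor : ∑ p ∈ Finset.Ioc Y N with (p.Prime ∧ p % m ∈ A), (N * (Λ p / p) - Λ p)
      ≤ ∑ p ∈ Finset.Ioc Y N with (p.Prime ∧ p % m ∈ A), Real.log p * ((N / p : ℕ) : ℝ) := by
    refine Finset.sum_le_sum fun p hp => ?_
    rw [Finset.mem_filter, Finset.mem_Ioc] at hp
    rw [vonMangoldt_apply_prime hp.2.1]
    have hp0 : (0 : ℝ) < p := by exact_mod_cast hp.2.1.pos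
    have h1 : (N : ℝ) / p - 1 ≤ ((N / p : ℕ) : ℝ) := by
      have := (Nat.lt_floor_add_one ((N : ℝ) / p)).le
      rw [Nat.floor_div_eq_div] at this
      linarith
    have h2 := mul_le_mul_of_nonneg_left h1 (Real.log_natCast_nonneg p)
    calc _ = Real.log p * ((N : ℝ) / p - 1) := by ring
      _ ≤ _ := h2
  rw [Finset.sum_sub_distrib, ← Finset.mul_sum] at hfloor
  have h5 := mul_le_mul_of_nonneg_left hmain (Nat.cast_nonneg (α := ℝ) N)
  have h6 : Real.log 4 * N ≤ 1.8 * N := by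
    gcongr; linarith
  nlinarith

end PrimeSums

/-! ### Lower bounds for `p`-adic linear forms -/

section LinearForms

lemma exists_prime_not_pow_dvd {W : ℤ} (hW : W ≠ 0) (S : Finset ℕ) (hS : ∀ p ∈ S, p.Prime)
    (e : ℕ → ℕ) (h : Real.log |(W : ℝ)| < ∑ p ∈ S, Real.log p * (e p : ℝ)) :
    ∃ p ∈ S, ¬ ((p : ℤ) ^ e p ∣ W) := by
  by_contra! hcon
  have hdvd : ∏ p ∈ S, p ^ e p ∣ W.natAbs := by
    refine Finset.prod_dvd_of_isRelPrime (fun p hp q hq hpq => ?_) fun p hp => ?_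
    · show IsRelPrime (p ^ e p) (q ^ e q)
      exact Nat.coprime_iff_isRelPrime.1 (Nat.Coprime.pow _ _
        ((Nat.coprime_primes (hS p hp) (hS q hq)).2 hpq))
    · have := hcon p hp
      rwa [← Int.natAbs_dvd_natAbs, Int.natAbs_pow, Int.natAbs_natCast] at this
  have hle := Nat.le_of_dvd (Int.natAbs_pos.2 hW) hdvd
  have hpos : ∀ p ∈ S, ((p : ℝ) ^ e p) ≠ 0 := fun p hp =>
    pow_ne_zero _ (by exact_mod_cast (hS p hp).ne_zero)
  have h1 : ∑ p ∈ S, Real.log p * (e p : ℝ) = Real.log ((∏ p ∈ S, p ^ e p : ℕ) : ℝ) := by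
    push_cast
    rw [Real.log_prod hpos]
    exact Finset.sum_congr rfl fun p _ => by rw [Real.log_pow, mul_comm]
  rw [h1] at h
  refine absurd h (not_lt.2 (Real.log_le_log ?_ ?_))
  · exact_mod_cast Finset.prod_pos fun p hp => pow_pos (hS p hp).pos _
  · rw [← Int.cast_abs, Int.abs_eq_natAbs]
    exact_mod_cast hle

lemma norm_factorial_le (p : ℕ) [Fact p.Prime] (n : ℕ) :
    ‖((n ! : ℕ) : ℚ_[p])‖ ≤ (p : ℝ) ^ (-((n / p : ℕ) : ℤ)) := by
  have hp : p.Prime := Fact.out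
  have h : p ^ (n / p) ∣ n ! := by
    rw [hp.pow_dvd_factorial_iff (Nat.lt_succ_self (Nat.log p n))]
    rcases Nat.eq_zero_or_pos (n / p) with h0 | h0
    · simp [h0]
    · have hlog : 1 ≤ Nat.log p n :=
        Nat.log_pos hp.one_lt ((Nat.div_pos_iff.1 h0).2)
      have := Finset.single_le_sum (s := Finset.Ico 1 (Nat.log p n).succ) (f := fun i => n / p ^ i)
        (fun _ _ => Nat.zero_le _) (a := 1) (Finset.mem_Ico.2 ⟨le_rfl, Nat.lt_succ_of_le hlog⟩)
      simpa using this
  have := (Padic.norm_int_le_pow_iff_dvd (p := p) ((n ! : ℕ) : ℤ) (n / p)).2 (by exact_mod_cast h)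
  simpa using this

lemma inv_abs_le_norm_intCast (p : ℕ) [Fact p.Prime] {W : ℤ} (hW : W ≠ 0) :
    |(W : ℝ)|⁻¹ ≤ ‖(W : ℚ_[p])‖ := by
  have hW' : (W : ℚ_[p]) ≠ 0 := by exact_mod_cast hW
  have hp : (0 : ℝ) < p := by exact_mod_cast (Fact.out : p.Prime).pos
  set v := padicValInt p W with hv
  have hn : ‖(W : ℚ_[p])‖ = (p : ℝ) ^ (-(v : ℤ)) := by
    rw [Padic.norm_eq_zpow_neg_valuation hW', Padic.valuation_intCast]
  have hd : ((p : ℤ) ^ v) ∣ W := padicValInt_dvd W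
  have hle : ((p : ℝ) ^ v) ≤ |(W : ℝ)| := by
    have := Int.le_of_dvd (abs_pos.2 hW) ((dvd_abs _ _).2 hd)
    exact_mod_cast this
  rw [hn, zpow_neg, zpow_natCast]
  exact inv_anti₀ (by positivity) hle

lemma inv_abs_le_norm_of_approx (p : ℕ) [Fact p.Prime] {B W : ℤ} (hW : W ≠ 0) {x : ℚ_[p]}
    {a b : ℕ} (h : ‖(B : ℚ_[p]) * x - W‖ ≤ ‖((a ! * b ! : ℕ) : ℚ_[p])‖)
    (hdvd : ¬ ((p : ℤ) ^ (a / p + b / p) ∣ W)) : |(W : ℝ)|⁻¹ ≤ ‖x‖ := by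
  have hp : (0 : ℝ) < p := by exact_mod_cast (Fact.out : p.Prime).pos
  have h1 : ‖((a ! * b ! : ℕ) : ℚ_[p])‖ ≤ (p : ℝ) ^ (-((a / p + b / p : ℕ) : ℤ)) := by
    rw [Nat.cast_mul, norm_mul, Nat.cast_add, neg_add, zpow_add₀ hp.ne']
    exact mul_le_mul (norm_factorial_le p a) (norm_factorial_le p b) (norm_nonneg _) (by positivity)
  have h2 : (p : ℝ) ^ (-((a / p + b / p : ℕ) : ℤ)) < ‖(W : ℚ_[p])‖ := by
    by_contra hcon
    exact hdvd ((Padic.norm_int_le_pow_iff_dvd W _).1 (not_lt.1 hcon))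
  have h3 : ‖(B : ℚ_[p]) * x - W‖ < ‖(W : ℚ_[p])‖ := h.trans_lt (h1.trans_lt h2)
  have h4 : ‖(B : ℚ_[p]) * x‖ = ‖(W : ℚ_[p])‖ := by
    have := IsUltrametricDist.norm_add_eq_max_of_norm_ne_norm (x := (B : ℚ_[p]) * x - W)
      (y := (W : ℚ_[p])) h3.ne
    rwa [sub_add_cancel, max_eq_right h3.le] at this
  calc |(W : ℝ)|⁻¹ ≤ ‖(W : ℚ_[p])‖ := inv_abs_le_norm_intCast p hW
    _ = ‖(B : ℚ_[p])‖ * ‖x‖ := by rw [← h4, norm_mul]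
    _ ≤ 1 * ‖x‖ := by gcongr; exact Padic.norm_int_le_one B
    _ = ‖x‖ := one_mul _

end LinearForms

section LowerBound

lemma mul_log_le_pred_mul_log_pred {x : ℝ} (hx : 1 < x) :
    x * Real.log x - Real.log x - 1 ≤ (x - 1) * Real.log (x - 1) := by
  have h1 : 0 < x - 1 := by linarith
  have h2 : Real.log x - Real.log (x - 1) ≤ x / (x - 1) - 1 := by
    rw [← Real.log_div (by linarith) h1.ne']
    exact Real.log_le_sub_one_of_pos (by positivity)
  have h3 : (x - 1) * (x / (x - 1) - 1) = 1 := by field_simp; ring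
  nlinarith [mul_le_mul_of_nonneg_left h2 h1.le]

lemma log_c1val {k : ℕ} {α : Fin k → ℤ} :
    Real.log (c1val k α) = k * Real.log (2 * maxAbs α) := by
  rw [c1val, ← mul_pow, Real.log_pow]

lemma maxAbs_pos {k : ℕ} (hk : 1 ≤ k) {α : Fin k → ℤ} (hα : ∀ j, α j ≠ 0) : 0 < maxAbs α :=
  (Int.natAbs_pos.2 (hα ⟨0, hk⟩)).trans_le
    (Finset.le_sup (f := fun j => (α j).natAbs) (Finset.mem_univ _))

set_option maxHeartbeats 1000000 in
theorem exists_prime_inv_le_norm {k m : ℕ} (hk : 1 ≤ k) (hm : 3 ≤ m)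
    {lam : Fin (k + 1) → ℤ} (hlam : ∃ i, lam i ≠ 0)
    {α : Fin k → ℤ} (hα : ∀ j, α j ≠ 0) (hαinj : Function.Injective α) (hGRH : GRH m)
    {ε : ℝ} (hε0 : 0 < ε) (hε1 : ε < 1)
    {A : Finset ℕ} (hA : ∀ a ∈ A, a < m ∧ Nat.Coprime a m)
    (hAcard : ((k : ℝ) + ε) * m.totient / (k + 1) ≤ A.card)
    {H : ℝ} (hH0 : 0 < H) (hH : ∀ i, (|lam i| : ℝ) ≤ H)
    {l Y : ℕ} {Q : ℝ} (hl : 2 ≤ l) (hQ0 : 0 < Q) (hQ : m.totient * Real.log m ≤ Q)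
    (hYl : Y ≤ l - 1) (hY : 6 * Q ≤ Real.log Y) (hN : 120 * Q ≤ Real.log ((l - 1 : ℕ) : ℝ))
    (hmain : Real.log H + Real.log (k + 1) + Real.log (k * l) + Real.log l + 1
      + l * Real.log k + l * Real.log (c1val k α) + (k + 1) * l * (Real.log Y + 78)
      < ε * (l * Real.log l)) :
    ∃ p : ℕ, ∃ _ : Fact p.Prime, p % m ∈ A ∧ Y < p ∧ p < k * l ∧
      ((k + 1) * H * ((k * l)! * (2 * (maxAbs α : ℝ)) ^ (k * l)))⁻¹ ≤
        ‖(lam 0 : ℚ_[p]) + ∑ j : Fin k, (lam j.succ : ℚ_[p]) * eulerF p (α j)‖ := by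
  obtain ⟨B, W, hW, hWle, hBW⟩ :=
    exists_pade_approximation α hk hl hα hαinj lam hlam H hH
  have hM := maxAbs_pos hk hα
  have hM' : (0 : ℝ) < maxAbs α := by exact_mod_cast hM
  have hk0 : (1 : ℝ) ≤ k := by exact_mod_cast hk
  have hl0 : (2 : ℝ) ≤ l := by exact_mod_cast hl
  have hkl : l ≤ k * l := Nat.le_mul_of_pos_left l hk
  have hn : l - 1 ≤ k * l - 1 := by omega
  have hY0 : 0 < Real.log Y := by linarith
  set r : ℝ := A.card / m.totient with hr
  have hφ : (0 : ℝ) < m.totient := by exact_mod_cast Nat.totient_pos.2 (by omega)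
  have hr1 : r ≤ 1 := by
    rw [hr, div_le_one hφ]; exact_mod_cast card_le_totient_of_coprime hA
  have hrk : (k + ε) / (k + 1) ≤ r := by
    rw [hr, le_div_iff₀ hφ]
    calc (k + ε) / (k + 1) * m.totient = (k + ε) * m.totient / (k + 1) := by ring
      _ ≤ _ := hAcard
  set D : ℝ := Real.log Y + 78 with hD
  set n₁ := k * l - 1 with hn₁
  set n₂ := l - 1 with hn₂
  set S := (Finset.Ioc Y n₁).filter (fun p => p.Prime ∧ p % m ∈ A) with hS
  have hn₁' : (n₁ : ℝ) = k * l - 1 := by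
    rw [hn₁, Nat.cast_sub (by omega)]; push_cast; ring
  have hn₂' : (n₂ : ℝ) = l - 1 := by
    rw [hn₂, Nat.cast_sub (by omega)]; push_cast; ring
  have hkl' : (l : ℝ) ≤ k * l := by nlinarith
  have key : ∀ n : ℕ, n₂ ≤ n → n ≤ n₁ →
      n * (r * Real.log n - D) ≤ ∑ p ∈ S, Real.log p * ((n / p : ℕ) : ℝ) := by
    intro n h2 h1
    have hn2pos : (0 : ℝ) < n₂ := by rw [hn₂']; linarith
    have hlog : Real.log n₂ ≤ Real.log n := Real.log_le_log hn2pos (by exact_mod_cast h2)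
    have := le_sum_prime_log_mul_div hm hGRH hA hQ0 hQ (hYl.trans h2) hY (hN.trans hlog)
    refine le_trans ?_ (this.trans ?_)
    · refine mul_le_mul_of_nonneg_left ?_ (Nat.cast_nonneg n)
      nlinarith
    · refine Finset.sum_le_sum_of_subset_of_nonneg ?_ fun p _ _ => ?_
      · exact Finset.filter_subset_filter _ (Finset.Ioc_subset_Ioc_right h1)
      · exact mul_nonneg (Real.log_natCast_nonneg p) (Nat.cast_nonneg _)
  have k1 := key n₁ hn le_rfl
  have k2 := key n₂ le_rfl hn
  have hWpos : (0 : ℝ) < |(W : ℝ)| := by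
    rw [abs_pos]; exact_mod_cast hW
  have hbig : Real.log |(W : ℝ)| ≤ Real.log (k + 1) + Real.log H + Real.log (k * l)
      + n₁ * Real.log n₁ + l * Real.log (c1val k α) := by
    refine (Real.log_le_log hWpos hWle).trans ?_
    have hfac : (k * l)! = k * l * n₁ ! := (Nat.mul_factorial_pred (by omega)).symm
    have hf0 : ((n₁ ! : ℕ) : ℝ) ≠ 0 := by exact_mod_cast (Nat.factorial_pos _).ne'
    rw [hfac, Nat.cast_mul, Nat.cast_mul, Real.log_mul (by positivity) (by positivity),
      Real.log_mul (by positivity) (by positivity), Real.log_mul (by positivity) (by positivity),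
      Real.log_mul (by positivity) (by positivity), Real.log_pow, log_c1val]
    have := log_factorial_le n₁
    push_cast
    nlinarith
  have hlt : Real.log |(W : ℝ)| < ∑ p ∈ S, Real.log p * ((n₁ / p + n₂ / p : ℕ) : ℝ) := by
    have hsum : ∑ p ∈ S, Real.log p * ((n₁ / p + n₂ / p : ℕ) : ℝ)
        = ∑ p ∈ S, Real.log p * ((n₁ / p : ℕ) : ℝ) + ∑ p ∈ S, Real.log p * ((n₂ / p : ℕ) : ℝ) := by
      rw [← Finset.sum_add_distrib]
      exact Finset.sum_congr rfl fun p _ => by push_cast; ring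
    rw [hsum]
    refine lt_of_le_of_lt hbig (lt_of_lt_of_le ?_ (add_le_add k1 k2))
    have hDpos : 0 < D := by linarith
    have hlogk : 0 ≤ Real.log k := Real.log_nonneg hk0
    have hlogl : 0 ≤ Real.log l := Real.log_nonneg (by linarith)
    have hA1 : n₁ * Real.log n₁ ≤ k * l * (Real.log k + Real.log l) := by
      rw [← Real.log_mul (by positivity) (by positivity), hn₁']
      refine mul_le_mul (by linarith) (Real.log_le_log (by linarith) (by linarith))
        (Real.log_nonneg ?_) (by positivity)
      nlinarith
    have hn1n : 0 ≤ n₁ * Real.log n₁ :=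
      mul_nonneg (Nat.cast_nonneg _) (Real.log_natCast_nonneg _)
    have hn2n : 0 ≤ n₂ * Real.log n₂ :=
      mul_nonneg (Nat.cast_nonneg _) (Real.log_natCast_nonneg _)
    have hA2 : n₁ * Real.log n₁ * (1 - r) ≤
        k * l * (Real.log k + Real.log l) * ((1 - ε) / (k + 1)) := by
      refine mul_le_mul hA1 ?_ (by linarith) (by positivity)
      have : (1 - ε) / (k + 1) = 1 - (k + ε) / ((k : ℝ) + 1) := by field_simp; ring
      linarith
    have hA3 : l * Real.log l - Real.log l - 1 ≤ n₂ * Real.log n₂ := by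
      rw [hn₂']; exact mul_log_le_pred_mul_log_pred (by linarith)
    have hρ1 : (k + ε) / ((k : ℝ) + 1) ≤ 1 := by
      rw [div_le_one (by linarith)]; linarith
    have hρ0 : 0 < (k + ε) / ((k : ℝ) + 1) := by positivity
    have hA4 : (k + ε) / (k + 1) * (l * Real.log l) - Real.log l - 1 ≤ r * (n₂ * Real.log n₂) := by
      nlinarith [mul_le_mul_of_nonneg_right hrk hn2n, mul_le_mul_of_nonneg_left hA3 hρ0.le]
    have hA5 : k * l * (Real.log k + Real.log l) * ((1 - ε) / (k + 1)) ≤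
        l * Real.log k + k * ((1 - ε) / (k + 1)) * (l * Real.log l) := by
      have : k * ((1 - ε) / (k + 1)) ≤ 1 := by
        rw [mul_div_assoc', div_le_one (by linarith)]; nlinarith
      nlinarith [mul_le_mul_of_nonneg_right this
        (mul_nonneg (by linarith : (0 : ℝ) ≤ l) hlogk)]
    have hA6 : (k + ε) / (k + 1) * (l * Real.log l) - k * ((1 - ε) / (k + 1)) * (l * Real.log l)
        = ε * (l * Real.log l) := by
      field_simp; ring
    have hA7 : (n₁ + n₂) * D ≤ (k + 1) * l * D := by
      rw [hn₁', hn₂']; nlinarith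
    linarith
  obtain ⟨p, hpS, hp⟩ := exists_prime_not_pow_dvd hW S
    (fun p hp => (Finset.mem_filter.1 hp).2.1) (fun p => n₁ / p + n₂ / p) hlt
  obtain ⟨hpI, hpP, hpA⟩ := Finset.mem_filter.1 hpS
  have hfact : Fact p.Prime := ⟨hpP⟩
  rw [Finset.mem_Ioc] at hpI
  refine ⟨p, hfact, hpA, hpI.1, by omega, ?_⟩
  exact (inv_anti₀ hWpos hWle).trans (inv_abs_le_norm_of_approx p hW (hBW p hfact) hp)

end LowerBound

section Parameters

lemma sub_one_le_log_sub_log_log {s X : ℝ} (hs : 2 ≤ s) (hX : s * Real.exp s ≤ X) :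
    s - 1 ≤ Real.log X - Real.log (Real.log X) := by
  have hs0 : 0 < s := by linarith
  have hlogs : 0 ≤ Real.log s := Real.log_nonneg (by linarith)
  set L₀ := s + Real.log s with hL₀
  have hL₀pos : 1 < L₀ := by linarith
  have hL : L₀ ≤ Real.log X := by
    have := Real.log_le_log (by positivity) hX
    rw [Real.log_mul hs0.ne' (Real.exp_pos s).ne', Real.log_exp] at this
    linarith
  set L := Real.log X
  have h1 : Real.log L - Real.log L₀ ≤ L - L₀ := by
    rw [← Real.log_div (by linarith) (by linarith)]
    refine (Real.log_le_sub_one_of_pos (by apply div_pos <;> linarith)).trans ?_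
    have : L / L₀ - 1 = (L - L₀) / L₀ := by field_simp
    rw [this]
    exact div_le_self (by linarith) hL₀pos.le
  have h2 : Real.log L₀ - Real.log s ≤ 1 := by
    rw [← Real.log_div (by linarith) hs0.ne']
    refine (Real.log_le_sub_one_of_pos (by apply div_pos <;> linarith)).trans ?_
    have : L₀ / s - 1 = Real.log s / s := by rw [hL₀]; field_simp; ring
    rw [this, div_le_one hs0]
    exact (Real.log_le_sub_one_of_pos hs0).trans (by linarith)
  linarith

lemma log_le_of_eighteen_hundred_le {L : ℝ} (hL : 1865 ≤ L) : Real.log L ≤ 0.00406 * L := by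
  have h : Real.log L - Real.log (2 ^ 11) ≤ L / 2 ^ 11 - 1 := by
    rw [← Real.log_div (by linarith) (by norm_num)]
    exact Real.log_le_sub_one_of_pos (by positivity)
  rw [Real.log_pow] at h
  have := Real.log_two_lt_d9
  push_cast at h
  linarith

lemma three_mul_log_le {u : ℝ} (hu : 12.3 ≤ u) : 3 * Real.log u ≤ 0.62 * u := by
  have h : Real.log u - Real.log (123 / 10) ≤ u / (123 / 10) - 1 := by
    rw [← Real.log_div (by linarith) (by norm_num)]
    exact Real.log_le_sub_one_of_pos (by positivity)
  have h2 : 3 * Real.log (123 / 10) ≤ 11 * Real.log 2 := by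
    have := Real.log_le_log (x := (123 / 10 : ℝ) ^ 3) (y := 2 ^ 11) (by norm_num) (by norm_num)
    rwa [Real.log_pow, Real.log_pow] at this
  have := Real.log_two_lt_d9
  linarith

lemma le_log_of_eighteen_hundred_le {q : ℝ} (hq : 1865 ≤ q) : 7.278 ≤ Real.log q := by
  have h2 := Real.log_le_log (x := (2 : ℝ) ^ 21) (y := q ^ 2) (by norm_num) (by nlinarith)
  rw [Real.log_pow, Real.log_pow] at h2
  have := Real.log_two_gt_d9
  push_cast at h2
  linarith

lemma log_add_one_le {x : ℝ} (hx : 0 < x) : Real.log (x + 1) ≤ Real.log x + 1 / x := by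
  have h : Real.log (x + 1) - Real.log x ≤ (x + 1) / x - 1 := by
    rw [← Real.log_div (by linarith) hx.ne']
    exact Real.log_le_sub_one_of_pos (by positivity)
  have : (x + 1) / x - 1 = 1 / x := by field_simp; ring
  linarith

lemma log_le_mul_of_million_le {x : ℝ} (hx : 1000000 ≤ x) : Real.log x ≤ 0.002 * x := by
  have h1 : (1000 : ℝ) ≤ √x := Real.le_sqrt_of_sq_le (by linarith)
  have h2 : √x * √x = x := Real.mul_self_sqrt (by linarith)
  have h3 : Real.log x = 2 * Real.log (√x) := by
    rw [Real.log_sqrt (by linarith)]; ring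
  have h4 := Real.log_le_sub_one_of_pos (show 0 < √x by linarith)
  nlinarith

set_option maxHeartbeats 1000000 in
theorem exists_parameters {k ε X L q u Q b : ℝ} (hk : 1 ≤ k) (hε0 : 0 < ε) (hε1 : ε < 1)
    (hX : 0 < X) (hL : L = Real.log X) (hq : q = L - Real.log L) (hQ : Q = Real.log q)
    (hL1 : 1865 ≤ L) (hq1 : 1865 ≤ q) (hu : 12.3 ≤ u) (huq : u ^ 3 = q)
    (hC : (15.195 * k + 16.195) / ε ≤ u ^ 2)
    (hk1 : Real.log (k + 1) ≤ Q) (hb0 : 0 ≤ b) (hb : b ≤ Q) :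
    ∃ l Y : ℕ, 2 ≤ l ∧ Y ≤ l - 1 ∧ 6 * Q ≤ Real.log Y ∧ 120 * Q ≤ Real.log ((l - 1 : ℕ) : ℝ) ∧
      ε * X + Real.log (k + 1) + Real.log (k * l) + Real.log l + 1
        + l * Real.log k + l * b + (k + 1) * l * (Real.log Y + 78) < ε * (l * Real.log l) ∧
      q ≤ Y ∧ (l : ℝ) < 12.994 * (X / L) + 2 ∧
      Real.log (k + 1) + ε * X + k * (l * (Real.log k + Real.log l)) + l * b
        < ε * X + k * X + 5 * k * ((15.195 * k + 16.195) / ε) * (Q * (X / L)) := by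
  have hQ1 : 7.278 ≤ Q := hQ ▸ le_log_of_eighteen_hundred_le hq1
  have hQu : Q ≤ 0.62 * u := by
    have : Q = 3 * Real.log u := by rw [hQ, ← huq, Real.log_pow]; norm_num
    rw [this]; exact three_mul_log_le hu
  have hlogL : Real.log L ≤ 0.00406 * L := log_le_of_eighteen_hundred_le hL1
  have hlogL0 : 0 ≤ Real.log L := Real.log_nonneg (by linarith)
  have hqL : q ≤ L := by linarith
  have hLq : L ≤ 1.0041 * q := by linarith
  have hlogk0 : 0 ≤ Real.log k := Real.log_nonneg hk
  have hlogk : Real.log k ≤ Q :=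
    (Real.log_le_log (by linarith) (by linarith)).trans hk1
  set C : ℝ := 15.195 * k + 16.195 with hCdef
  set G : ℝ := C / ε with hG
  have hεG : ε * G = C := by rw [hG]; field_simp
  have hG1 : C ≤ G := by
    rw [hG, le_div_iff₀ hε0]
    exact mul_le_of_le_one_right (by positivity) hε1.le
  set τ : ℝ := 1.2 * G * Q with hτ
  have hτ0 : 0 < τ := by positivity
  have hτq : τ ≤ 0.744 * q := by
    have : G * Q ≤ u ^ 2 * (0.62 * u) := by
      refine mul_le_mul hC hQu (by linarith) (by positivity)
    rw [hτ, ← huq]; linarith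
  set d := q - τ with hd
  have hd0 : 0.256 * q ≤ d := by linarith
  have hdq : d ≤ q := by linarith
  have hdpos : 0 < d := by linarith
  set x := X / L with hx
  have hLpos : 0 < L := by linarith
  have hxX : x * L = X := by rw [hx]; field_simp
  have hx0 : 0 < x := by positivity
  have hlogx : Real.log x = q := by
    rw [hx, Real.log_div hX.ne' hLpos.ne', ← hL, hq]
  have hxbig : 1000000 ≤ x := by
    rw [← Real.exp_log hx0, hlogx]
    have h1 := Real.quadratic_le_exp_of_nonneg (show 0 ≤ q by linarith)
    have h2 := mul_le_mul_of_nonneg_right hq1 (show 0 ≤ q by linarith)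
    linarith
  set z := X / d with hz
  have hzd : z * d = X := by rw [hz]; field_simp
  have hxz : x ≤ z := by
    rw [hx, hz]; exact div_le_div_of_nonneg_left hX.le hdpos (hdq.trans hqL)
  have hzx : z ≤ 3.923 * x := by
    rw [hz, div_le_iff₀ hdpos, ← hxX]
    have h1 : L ≤ 3.923 * d := by linarith
    have h2 := mul_le_mul_of_nonneg_left h1 hx0.le
    linarith
  have hz0 : 0 < z := by linarith
  have hlogz : q ≤ Real.log z := hlogx ▸ Real.log_le_log hx0 hxz
  have hlogz2 : Real.log z ≤ q + 1.37 := by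
    have := Real.log_le_log hz0 hzx
    rw [Real.log_mul (by norm_num) hx0.ne', hlogx] at this
    have h2 : Real.log 3.923 ≤ 1.37 := by
      have := Real.log_le_log (x := 3.923) (y := (2 : ℝ) ^ 2 * 0.98075) (by norm_num) (by norm_num)
      rw [Real.log_mul (by norm_num) (by norm_num), Real.log_pow] at this
      have h3 := Real.log_le_sub_one_of_pos (show (0 : ℝ) < 0.98075 by norm_num)
      have := Real.log_two_lt_d9
      push_cast at *
      linarith
    linarith
  obtain ⟨l, hl⟩ : ∃ l : ℕ, l = ⌈z⌉₊ := ⟨_, rfl⟩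
  have hzl : z ≤ l := hl ▸ Nat.le_ceil z
  have hlz : (l : ℝ) < z + 1 := hl ▸ Nat.ceil_lt_add_one hz0.le
  have hl0 : (1000000 : ℝ) ≤ l := by linarith
  have hl2 : 2 ≤ l := by
    have : (2 : ℝ) ≤ l := by linarith
    exact_mod_cast this
  obtain ⟨Y, hY⟩ : ∃ Y : ℕ, Y = ⌈q⌉₊ ^ 6 := ⟨_, rfl⟩
  have hq0 : 0 < q := by linarith
  have hceil : q ≤ (⌈q⌉₊ : ℝ) := Nat.le_ceil q
  have hceil2 : (⌈q⌉₊ : ℝ) < q + 1 := Nat.ceil_lt_add_one hq0.le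
  have hlogY : Real.log Y = 6 * Real.log (⌈q⌉₊ : ℝ) := by
    rw [hY]; push_cast; rw [Real.log_pow]; norm_num
  have hYlo : 6 * Q ≤ Real.log Y := by
    rw [hlogY, hQ]; linarith [Real.log_le_log hq0 hceil]
  have hYhi : Real.log Y ≤ 6 * Q + 0.0033 := by
    have h1 := Real.log_le_log (by linarith) hceil2.le
    have h2 := log_add_one_le hq0
    have h3 : 1 / q ≤ 1 / 1865 := one_div_le_one_div_of_le (by norm_num) hq1
    have h4 : (1 : ℝ) / 1865 ≤ 0.00055 := by norm_num
    rw [hlogY, hQ]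
    linarith
  have hl1 : ((l - 1 : ℕ) : ℝ) = l - 1 := by rw [Nat.cast_sub (by omega)]; norm_num
  have h120 : 120 * Q ≤ Real.log ((l - 1 : ℕ) : ℝ) := by
    have h1 : Real.log (x / 2) ≤ Real.log ((l - 1 : ℕ) : ℝ) :=
      Real.log_le_log (by positivity) (by rw [hl1]; linarith)
    rw [Real.log_div hx0.ne' (by norm_num), hlogx] at h1
    have := Real.log_two_lt_d9
    have h2 : 151.29 * u ≤ q := by rw [← huq]; nlinarith [mul_self_nonneg (u - 12.3)]
    linarith
  have hYl : Y ≤ l - 1 := by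
    have hYpos : (0 : ℝ) < Y := by rw [hY]; push_cast; positivity
    have : (Y : ℝ) ≤ ((l - 1 : ℕ) : ℝ) := by
      rw [← Real.log_le_log_iff hYpos (by rw [hl1]; linarith)]
      linarith
    exact_mod_cast this
  have hlogl : q ≤ Real.log l := hlogz.trans (Real.log_le_log hz0 hzl)
  have hlogl2 : Real.log l ≤ 0.002 * l := log_le_mul_of_million_le hl0
  have hlpos : (0 : ℝ) < l := by linarith
  refine ⟨l, Y, hl2, hYl, hYlo, h120, ?_, ?_, by linarith, ?_⟩
  · have h1 : ε * X + l * (1.2 * C * Q) ≤ ε * (l * Real.log l) := by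
      have e1 : X ≤ l * (Real.log l - τ) := by
        rw [← hzd]
        exact mul_le_mul hzl (by linarith) hdpos.le hlpos.le
      have e2 : l * (1.2 * C * Q) = ε * (l * τ) := by rw [hτ, ← hεG]; ring
      have e3 := mul_le_mul_of_nonneg_left e1 hε0.le
      rw [e2]
      linarith
    have h2 : Real.log (k * l) = Real.log k + Real.log l :=
      Real.log_mul (by linarith) hlpos.ne'
    have hlQ : 7.278 * l ≤ l * Q := by
      have := mul_le_mul_of_nonneg_left hQ1 hlpos.le
      linarith
    have h3 : l * Real.log k ≤ l * Q := by gcongr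
    have h4 : l * b ≤ l * Q := by gcongr
    have h5 : (k + 1) * l * (Real.log Y + 78) ≤ (k + 1) * (16.72 * (l * Q)) := by
      rw [mul_assoc]
      have : l * (Real.log Y + 78) ≤ l * (16.72 * Q) := by
        gcongr
        linarith
      exact mul_le_mul_of_nonneg_left (this.trans_eq (by ring)) (by linarith)
    have h6 : 2 * Q ≤ 0.001 * (l * Q) := by
      have := mul_le_mul_of_nonneg_right hl0 (show 0 ≤ Q by linarith)
      linarith
    have h7 : 0 < l * Q := by linarith
    have h8 : (k + 1) * (16.72 * (l * Q)) + 2.01 * (l * Q) < l * (1.2 * C * Q) := by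
      have : 0 ≤ k * (l * Q) := by positivity
      rw [hCdef]
      linarith
    linarith
  · refine hceil.trans ?_
    rw [hY]; push_cast
    exact le_self_pow₀ (by linarith) (by norm_num)
  · have e1 : Real.log l ≤ Real.log z + 1 / z :=
      (Real.log_le_log hlpos hlz.le).trans (log_add_one_le hz0)
    have hz1 : z * (1 / z) = 1 := by field_simp
    have hz2 : 1 / z ≤ 1 := by rw [div_le_one hz0]; linarith
    have hlz2 := log_le_mul_of_million_le (show 1000000 ≤ z by linarith)
    have e2 : l * Real.log l ≤ X + z * τ + 1.38 * z := by
      have a1 : l * Real.log l ≤ (z + 1) * (Real.log z + 1 / z) :=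
        mul_le_mul hlz.le e1 (by linarith) (by linarith)
      have a2 : z * Real.log z ≤ z * (d + τ + 1.37) := by gcongr; linarith
      have a3 : z * (d + τ + 1.37) = X + z * τ + 1.37 * z := by rw [← hzd]; ring
      have a4 : (z + 1) * (Real.log z + 1 / z)
          = z * Real.log z + z * (1 / z) + Real.log z + 1 / z := by ring
      rw [hz1] at a4
      linarith
    have hzQ : 7.278 * z ≤ z * Q := by
      have := mul_le_mul_of_nonneg_left hQ1 hz0.le
      linarith
    have hQz : Q ≤ 0.001 * (z * Q) := by
      have := mul_le_mul_of_nonneg_right (hxbig.trans hxz) (show 0 ≤ Q by linarith)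
      linarith
    have e3 : l * Real.log k ≤ 1.001 * (z * Q) := by
      have : l * Real.log k ≤ (z + 1) * Q := mul_le_mul hlz.le hlogk hlogk0 (by linarith)
      linarith
    have e4 : l * b ≤ 1.001 * (z * Q) := by
      have : l * b ≤ (z + 1) * Q := mul_le_mul hlz.le hb hb0 (by linarith)
      linarith
    have e6 : k * (l * (Real.log k + Real.log l)) ≤ k * (X + z * τ + 1.195 * (z * Q)) := by
      gcongr
      rw [mul_add]
      linarith
    have hzτ : z * τ = 1.2 * G * (z * Q) := by rw [hτ]; ring
    have hzQ0 : 0 < z * Q := by linarith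
    have hG2 : 31.39 ≤ G := by linarith
    have e7 : k * (z * τ + 1.195 * (z * Q)) + 1.002 * (z * Q) ≤ k * (1.2702 * G * (z * Q)) := by
      have : 1.002 * (z * Q) ≤ k * (1.002 * (z * Q)) := le_mul_of_one_le_left (by positivity) hk
      have : k * (z * τ + 1.195 * (z * Q) + 1.002 * (z * Q)) ≤ k * (1.2702 * G * (z * Q)) := by
        gcongr
        have := mul_le_mul_of_nonneg_right hG2 hzQ0.le
        rw [hzτ]
        linarith
      linarith
    have e8 : k * (1.2702 * G * (z * Q)) < 5 * k * G * (Q * x) := by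
      have h1 : z * Q ≤ 3.923 * (Q * x) := by
        have := mul_le_mul_of_nonneg_right hzx (show 0 ≤ Q by linarith)
        linarith
      have h2 : 0 < k * G * (Q * x) := by positivity
      have h3 : k * G * (z * Q) ≤ k * G * (3.923 * (Q * x)) := by gcongr
      linarith
    linarith

end Parameters

section MainBound

lemma le_log_mul_mul {k ε X L q u c : ℝ} (hk : 1 ≤ k) (hε0 : 0 < ε) (hX : 0 < X)
    (hL : L = Real.log X) (hq : q = L - Real.log L) (hL1 : 1865 ≤ L) (hq1 : 1865 ≤ q)
    (hu : 12.3 ≤ u) (huq : u ^ 3 = q) (hC : (15.195 * k + 16.195) / ε ≤ u ^ 2)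
    (hc : 0.02 ≤ c) : q ≤ Real.log (c * (ε * X)) := by
  have hLpos : 0 < L := by linarith
  have hqL : q ≤ L := by
    have : 0 ≤ Real.log L := Real.log_nonneg (by linarith)
    linarith
  have hxq : Real.log (X / L) = q := by rw [Real.log_div hX.ne' hLpos.ne', ← hL, hq]
  refine hxq.symm.le.trans ?_
  refine Real.log_le_log (by positivity) ?_
  rw [div_le_iff₀ hLpos]
  have h1 : 31.39 ≤ u ^ 2 * ε := by
    rw [div_le_iff₀ hε0] at hC
    linarith
  have h2 : 1 ≤ c * ε * L := by
    calc (1 : ℝ) ≤ 0.02 * (31.39 * u) := by linarith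
      _ ≤ 0.02 * (u ^ 2 * ε * u) := by gcongr
      _ = 0.02 * ε * q := by rw [← huq]; ring
      _ ≤ c * ε * L := by gcongr
  calc X = 1 * X := (one_mul X).symm
    _ ≤ c * ε * L * X := by gcongr
    _ = c * (ε * X) * L := by ring

set_option maxHeartbeats 1000000 in
theorem exists_prime_rpow_lt_norm {k m : ℕ} (hk : 1 ≤ k) (hm : 3 ≤ m)
    {lam : Fin (k + 1) → ℤ} (hlam : ∃ i, lam i ≠ 0)
    {α : Fin k → ℤ} (hα : ∀ j, α j ≠ 0) (hαinj : Function.Injective α) (hGRH : GRH m)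
    {ε : ℝ} (hε0 : 0 < ε) (hε1 : ε < 1)
    {A : Finset ℕ} (hA : ∀ a ∈ A, a < m ∧ Nat.Coprime a m)
    (hAcard : ((k : ℝ) + ε) * m.totient / (k + 1) ≤ A.card)
    {H : ℝ} (hH : ∀ i, (|lam i| : ℝ) ≤ H) {s : ℝ}
    (hs : s ≥ max (max 1866 ((m : ℝ) ^ m.totient + 1))
      (max (c1val k α + 1) (((15.195 * k + 16.195) / ε) ^ (1.5 : ℝ) + 1)))
    (hHs : Real.log H / ε ≥ s * Real.exp s)
    {E c : ℝ} (hc : 0.02 ≤ c) (hE : 5 * k * ((15.195 * k + 16.195) / ε) ≤ E) :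
    ∃ p : ℕ, (p.Prime ∧ p % m ∈ A) ∧
      Real.log (Real.log H / (ε * Real.log (Real.log H / ε))) < (p : ℝ) ∧
      (p : ℝ) < k * (12.994 * Real.log H / (ε * Real.log (Real.log H / ε)) + 2) ∧
      ∃ _ : Fact p.Prime,
        H ^ (-((k : ℝ) / ε + 1) -
            E * Real.log (Real.log (c * Real.log H)) / (ε * Real.log (Real.log H))) <
          ‖(lam 0 : ℚ_[p]) + ∑ j : Fin k, (lam j.succ : ℚ_[p]) * eulerF p (α j)‖ := by
  have hkR : (1 : ℝ) ≤ k := by exact_mod_cast hk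
  have hs1 : 1866 ≤ s := (le_max_left _ _).trans ((le_max_left _ _).trans hs)
  have hs2 : (m : ℝ) ^ m.totient + 1 ≤ s := (le_max_right _ _).trans ((le_max_left _ _).trans hs)
  have hs3 : c1val k α + 1 ≤ s := (le_max_left _ _).trans ((le_max_right _ _).trans hs)
  have hs4 : ((15.195 * k + 16.195) / ε) ^ (1.5 : ℝ) + 1 ≤ s :=
    (le_max_right _ _).trans ((le_max_right _ _).trans hs)
  obtain ⟨X, hXdef⟩ : ∃ X, X = Real.log H / ε := ⟨_, rfl⟩
  rw [← hXdef] at hHs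
  have hX : 0 < X := lt_of_lt_of_le (by positivity) hHs
  have hlogH : Real.log H = ε * X := by rw [hXdef]; field_simp
  have hH0 : 0 < H := by
    have h0 : 0 ≤ H := (abs_nonneg _).trans (hH 0)
    refine h0.lt_of_ne' fun h => ?_
    rw [h, Real.log_zero] at hlogH
    have : 0 < ε * X := by positivity
    linarith
  obtain ⟨L, hL⟩ : ∃ L, L = Real.log X := ⟨_, rfl⟩
  obtain ⟨q, hq⟩ : ∃ q, q = L - Real.log L := ⟨_, rfl⟩
  obtain ⟨Q, hQ⟩ : ∃ Q, Q = Real.log q := ⟨_, rfl⟩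
  have hsq : s - 1 ≤ q := by
    rw [hq, hL]; exact sub_one_le_log_sub_log_log (by linarith) hHs
  have hq1 : 1865 ≤ q := by linarith
  have hL1 : 1865 ≤ L := by
    have h1 := Real.log_le_log (by positivity) hHs
    rw [Real.log_mul (by linarith) (Real.exp_pos s).ne', Real.log_exp, ← hL] at h1
    have := Real.log_nonneg (show 1 ≤ s by linarith)
    linarith
  have hLpos : 0 < L := by linarith
  obtain ⟨u, hu⟩ : ∃ u, u = q ^ (1 / 3 : ℝ) := ⟨_, rfl⟩
  have hu0 : 0 ≤ u := hu ▸ Real.rpow_nonneg (by linarith) _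
  have huq : u ^ 3 = q := by
    rw [hu, ← Real.rpow_natCast, ← Real.rpow_mul (by linarith)]; norm_num
  have hu1 : 12.3 ≤ u := by
    refine le_of_pow_le_pow_left₀ (n := 3) (by norm_num) hu0 ?_
    rw [huq]; norm_num; linarith
  have hG0 : 0 < (15.195 * k + 16.195) / ε := by positivity
  have hC : (15.195 * k + 16.195) / ε ≤ u ^ 2 := by
    have h1 : ((15.195 * k + 16.195) / ε) ^ (1.5 : ℝ) ≤ q := by linarith
    have h2 := Real.rpow_le_rpow (by positivity) h1 (show (0 : ℝ) ≤ 2 / 3 by norm_num)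
    rw [← Real.rpow_mul hG0.le] at h2
    have h3 : q ^ (2 / 3 : ℝ) = u ^ 2 := by
      rw [hu, ← Real.rpow_natCast, ← Real.rpow_mul (by linarith)]; norm_num
    norm_num at h2 h3 ⊢
    linarith
  have hM : (1 : ℝ) ≤ maxAbs α := by exact_mod_cast maxAbs_pos hk hα
  have hc2 : (2 : ℝ) ^ k ≤ c1val k α := by
    rw [c1val]; exact le_mul_of_one_le_right (by positivity) (one_le_pow₀ hM)
  have hc1 : (1 : ℝ) ≤ c1val k α := (one_le_pow₀ (by norm_num)).trans hc2
  have hb0 : 0 ≤ Real.log (c1val k α) := Real.log_nonneg hc1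
  have hb : Real.log (c1val k α) ≤ Q := hQ ▸ Real.log_le_log (by linarith) (by linarith)
  have hk2 : (k : ℝ) + 1 ≤ c1val k α := by
    refine le_trans ?_ hc2
    exact_mod_cast Nat.lt_two_pow_self (n := k)
  have hk1 : Real.log ((k : ℝ) + 1) ≤ Q :=
    (Real.log_le_log (by linarith) hk2).trans hb
  have hmQ : m.totient * Real.log m ≤ Q := by
    rw [← Real.log_pow, hQ]
    refine Real.log_le_log (pow_pos ?_ _) (by linarith)
    exact_mod_cast (show 0 < m by omega)
  have hQ0 : 0 < Q := hQ ▸ Real.log_pos (by linarith)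
  obtain ⟨l, Y, hl, hYl, hY, hN, hmain, hqY, hlx, hW⟩ :=
    exists_parameters hkR hε0 hε1 hX hL hq hQ hL1 hq1 hu1 huq hC hk1 hb0 hb
  rw [← hlogH] at hmain hW
  obtain ⟨p, hfact, hpA, hYp, hpl, hp⟩ := exists_prime_inv_le_norm hk hm hlam hα hαinj hGRH hε0 hε1
    hA hAcard hH0 hH hl hQ0 hmQ hYl hY hN hmain
  have hxe : Real.log H / (ε * Real.log (Real.log H / ε)) = X / L := by
    rw [← hXdef, ← hL, hXdef, div_div]
  refine ⟨p, ⟨hfact.out, hpA⟩, ?_, ?_, hfact, lt_of_lt_of_le ?_ hp⟩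
  · rw [hxe, Real.log_div hX.ne' hLpos.ne', ← hL, ← hq]
    exact hqY.trans_lt (by exact_mod_cast hYp)
  · rw [mul_div_assoc, hxe]
    calc (p : ℝ) < k * l := by exact_mod_cast hpl
      _ ≤ _ := by gcongr
  · have hl0 : (0 : ℝ) < l := by positivity
    have hWpos : 0 < (k + 1) * H * ((k * l)! * (2 * (maxAbs α : ℝ)) ^ (k * l)) := by positivity
    rw [← Real.log_lt_log_iff (Real.rpow_pos_of_pos hH0 _) (inv_pos.2 hWpos),
      Real.log_rpow hH0, Real.log_inv]
    have hlogW : Real.log ((k + 1) * H * ((k * l)! * (2 * (maxAbs α : ℝ)) ^ (k * l))) ≤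
        Real.log (k + 1) + Real.log H + k * (l * (Real.log k + Real.log l))
          + l * Real.log (c1val k α) := by
      have hf0 : (((k * l)! : ℕ) : ℝ) ≠ 0 := by exact_mod_cast (Nat.factorial_pos _).ne'
      rw [Real.log_mul (by positivity) (by positivity), Real.log_mul (by positivity) hH0.ne',
        Real.log_mul hf0 (by positivity), Real.log_pow, log_c1val]
      have := log_factorial_le (k * l)
      rw [Nat.cast_mul, Real.log_mul (by positivity) hl0.ne'] at this
      rw [Nat.cast_mul]
      linarith
    have hll : Q ≤ Real.log (Real.log (c * Real.log H)) := by
      rw [hQ, hlogH]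
      exact Real.log_le_log (by linarith) (le_log_mul_mul hkR hε0 hX hL hq hL1 hq1 hu1 huq hC hc)
    have hll2 : Real.log (Real.log H) ≤ L := by
      rw [hL, hlogH]
      exact Real.log_le_log (by positivity) (mul_le_of_le_one_left hX.le hε1.le)
    have hll0 : 0 < Real.log (Real.log H) := by
      have := le_log_mul_mul hkR hε0 hX hL hq hL1 hq1 hu1 huq hC (c := 1) (by norm_num)
      rw [one_mul, ← hlogH] at this
      linarith
    have hQx : Q * (X / L) ≤
        Real.log (Real.log (c * Real.log H)) / (ε * Real.log (Real.log H)) * Real.log H := by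
      have : Real.log (Real.log (c * Real.log H)) / (ε * Real.log (Real.log H)) * Real.log H
          = Real.log (Real.log (c * Real.log H)) * (X / Real.log (Real.log H)) := by
        rw [hXdef]; field_simp
      rw [this]
      exact mul_le_mul hll (div_le_div_of_nonneg_left hX.le hll0 hll2) (by positivity)
        (hQ0.le.trans hll)
    have hE2 : 5 * k * ((15.195 * k + 16.195) / ε) * (Q * (X / L)) ≤
        E * (Real.log (Real.log (c * Real.log H)) / (ε * Real.log (Real.log H)) * Real.log H) :=
      mul_le_mul hE hQx (by positivity) (hG0.le.trans (by nlinarith))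
    have hkX : k / ε * Real.log H = k * X := by rw [hXdef]; ring
    have hexp : (-((k : ℝ) / ε + 1) -
            E * Real.log (Real.log (c * Real.log H)) / (ε * Real.log (Real.log H))) * Real.log H
        = -(Real.log H + k / ε * Real.log H +
          E * (Real.log (Real.log (c * Real.log H)) / (ε * Real.log (Real.log H)) * Real.log H)) := by
      ring
    rw [hexp, hkX]
    linarith

end MainBound

/-- Lower bound with exponent bounded in `H`, taking primes in
at least `(k+ε)φ(m)/(k+1)` residue classes. -/
theorem statement4 (k m : ℕ) (hk : 1 ≤ k) (hm : 3 ≤ m)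
    (lam : Fin (k + 1) → ℤ) (hlam : ∃ i, lam i ≠ 0)
    (α : Fin k → ℤ) (hα : ∀ j, α j ≠ 0) (hαinj : Function.Injective α)
    (hRH : RH) (hGRH : GRH m)
    (ε : ℝ) (hε : ε ∈ Set.Ioo (0 : ℝ) 1)
    (A : Finset ℕ) (hA : ∀ a ∈ A, a < m ∧ Nat.Coprime a m)
    (hAcard : ((k : ℝ) + ε) * m.totient / (k + 1) ≤ A.card)
    (R : Set ℕ) (hR : R = {p : ℕ | p.Prime ∧ p % m ∈ A})
    (H : ℝ) (hH : ∀ i, (|lam i| : ℝ) ≤ H)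
    (s : ℝ)
    (hs : s ≥ max (max 1866 ((m : ℝ) ^ m.totient + 1))
      (max (c1val k α + 1) (((15.195 * k + 16.195) / ε) ^ (1.5 : ℝ) + 1)))
    (hHs : Real.log H / ε ≥ s * Real.exp s) :
    (∃ p : ℕ, p ∈ R ∧
      Real.log (Real.log H / (ε * Real.log (Real.log H / ε))) < (p : ℝ) ∧
      (p : ℝ) < k * (12.994 * Real.log H / (ε * Real.log (Real.log H / ε)) + 2) ∧
      ∃ _ : Fact p.Prime,
        H ^ (-((k : ℝ) / ε + 1) -
            (197.444 * k ^ 2 / ε + 210.438 * k / ε + 1.726 * k ^ 2 - 0.529 * k + 12.995) *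
              Real.log (Real.log (0.072 * Real.log H)) / (ε * Real.log (Real.log H))) <
          ‖(lam 0 : ℚ_[p]) + ∑ j : Fin k, (lam j.succ : ℚ_[p]) * eulerF p (α j)‖) ∧
    (2 ≤ k → ∃ p : ℕ, p ∈ R ∧
      Real.log (Real.log H / (ε * Real.log (Real.log H / ε))) < (p : ℝ) ∧
      (p : ℝ) < k * (12.994 * Real.log H / (ε * Real.log (Real.log H / ε)) + 2) ∧
      ∃ _ : Fact p.Prime,
        H ^ (-((k : ℝ) / ε + 1) -
            (97.932 * k ^ 2 / ε + 104.377 * k / ε + 0.856 * k ^ 2 - 0.262 * k + 6.446) *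
              Real.log (Real.log (0.02 * Real.log H)) / (ε * Real.log (Real.log H))) <
          ‖(lam 0 : ℚ_[p]) + ∑ j : Fin k, (lam j.succ : ℚ_[p]) * eulerF p (α j)‖) := by
  obtain ⟨hε0, hε1⟩ := hε
  subst hR
  have hkR : (1 : ℝ) ≤ k := by exact_mod_cast hk
  have hw0 : 0 ≤ (k : ℝ) ^ 2 / ε := by positivity
  have hv0 : 0 ≤ (k : ℝ) / ε := by positivity
  have hsplit : ∀ a b : ℝ, 5 * k * ((a * k + b) / ε) = 5 * a * (k ^ 2 / ε) + 5 * b * (k / ε) :=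
    fun a b => by ring
  refine ⟨exists_prime_rpow_lt_norm hk hm hlam hα hαinj hGRH hε0 hε1 hA hAcard hH hs hHs
    (by norm_num) ?_, fun _ => exists_prime_rpow_lt_norm hk hm hlam hα hαinj hGRH hε0 hε1 hA
    hAcard hH hs hHs (by norm_num) ?_⟩ <;>
  · rw [hsplit, mul_div_assoc, mul_div_assoc]
    nlinarith
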